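/- arXiv:1201.2619 — 5 statements merged into one kernel-verified Lean document; each statement's English description precedes it below -/
import Mathlib

section
/- Let n ∈ ℕ, K ≥ 1, r > 0, and let f : ℝⁿ → ℝⁿ be Lipschitz on ℝⁿ with constant L > 0 and f(0) = 0. Let φ be a global solution map of ẋ = f(x) with ‖φ(t,y)‖ ≤ K‖y‖ for all t ≥ 0 and all y ∈ B_{2Kr}. Let T > 0 satisfy T·L < 1 and T·sup_{y∈B_{4Kr}} ‖f(y)‖ < 2Kr, let k ≥ 1, and set d := T·L. Fix x ∈ B_r, an integer i ≥ 1, and c with 0 ≤ c ≤ K such that ‖G_{i−1}ᵏ(T,x) − φ(iT,x)‖ ≤ c·‖x‖. Then for all t ∈ [iT, iT+T]: ‖G_iᵏ(t−iT, x) − φ(t,x)‖ ≤ ((e^{TL} + K·dᵏ)·c + K²·dᵏ)·‖x‖. -/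
/-- The Picard operator acting on functions `z : ℝ × ℝⁿ → ℝⁿ`:
`(P z)(t,x) = x + ∫₀ᵗ f(z(s,x)) ds`. -/
noncomputable def picardT {n : ℕ} (f : EuclideanSpace ℝ (Fin n) → EuclideanSpace ℝ (Fin n))
    (z : ℝ → EuclideanSpace ℝ (Fin n) → EuclideanSpace ℝ (Fin n)) :
    ℝ → EuclideanSpace ℝ (Fin n) → EuclideanSpace ℝ (Fin n) :=
  fun t x => x + ∫ s in (0:ℝ)..t, f (z s x)

/-- The extended Picard iterates: `G₀ᵏ = Pᵏ 0`, `G_{i+1}ᵏ(t,x) = (Pᵏ 0)(t, G_iᵏ(T,x))`. -/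
noncomputable def GIter {n : ℕ} (f : EuclideanSpace ℝ (Fin n) → EuclideanSpace ℝ (Fin n))
    (T : ℝ) (k : ℕ) : ℕ → ℝ → EuclideanSpace ℝ (Fin n) → EuclideanSpace ℝ (Fin n)
  | 0 => (picardT f)^[k] 0
  | (i + 1) => fun t x => (picardT f)^[k] 0 t (GIter f T k i T x)

section Picard

variable {n : ℕ} {f : EuclideanSpace ℝ (Fin n) → EuclideanSpace ℝ (Fin n)}

theorem continuous_picardT_iterate (hf : Continuous f) (k : ℕ) (y : EuclideanSpace ℝ (Fin n)) :
    Continuous fun s => (picardT f)^[k] 0 s y := by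
  induction k with
  | zero => exact continuous_const
  | succ k ih =>
    simp only [Function.iterate_succ_apply']
    exact continuous_const.add
      (intervalIntegral.continuous_primitive (fun a b => (hf.comp ih).intervalIntegrable a b) 0)

/-- A priori error estimate for the Picard iterates started at the zero function. -/
theorem norm_picardT_iterate_sub_le {L T M : ℝ} (hL : 0 ≤ L)
    (hfL : ∀ y z : EuclideanSpace ℝ (Fin n), ‖f y - f z‖ ≤ L * ‖y - z‖) (hf : Continuous f)
    {u : ℝ → EuclideanSpace ℝ (Fin n)} {y : EuclideanSpace ℝ (Fin n)} (hu0 : u 0 = y)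
    (hu : ∀ t ≥ (0 : ℝ), HasDerivAt u (f (u t)) t)
    (hM : ∀ t ≥ (0 : ℝ), ‖u t‖ ≤ M) (k : ℕ) :
    ∀ s ∈ Set.Icc 0 T, ‖(picardT f)^[k] 0 s y - u s‖ ≤ (T * L) ^ k * M := by
  induction k with
  | zero =>
    intro s hs
    simpa using hM s hs.1
  | succ k ih =>
    intro s hs
    have hM0 : 0 ≤ M := (norm_nonneg _).trans (hM 0 le_rfl)
    have hT : 0 ≤ T := hs.1.trans hs.2
    have hint : IntervalIntegrable (fun v => f (u v)) MeasureTheory.volume 0 s := by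
      refine ContinuousOn.intervalIntegrable fun v hv => ?_
      rw [Set.uIcc_of_le hs.1] at hv
      exact (hf.continuousAt.comp (hu v hv.1).continuousAt).continuousWithinAt
    have hpint : IntervalIntegrable (fun v => f ((picardT f)^[k] 0 v y)) MeasureTheory.volume 0 s :=
      (hf.comp (continuous_picardT_iterate hf k y)).intervalIntegrable 0 s
    have hftc : ∫ v in (0 : ℝ)..s, f (u v) = u s - u 0 := by
      refine intervalIntegral.integral_eq_sub_of_hasDerivAt (fun v hv => ?_) hint
      rw [Set.uIcc_of_le hs.1] at hv
      exact hu v hv.1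
    have hdiff : (picardT f)^[k + 1] 0 s y - u s =
        ∫ v in (0 : ℝ)..s, (f ((picardT f)^[k] 0 v y) - f (u v)) := by
      rw [intervalIntegral.integral_sub hpint hint, hftc, hu0,
        Function.iterate_succ_apply']
      simp only [picardT]
      abel
    rw [hdiff]
    calc ‖∫ v in (0 : ℝ)..s, (f ((picardT f)^[k] 0 v y) - f (u v))‖
        ≤ L * ((T * L) ^ k * M) * |s - 0| := by
          refine intervalIntegral.norm_integral_le_of_norm_le_const fun v hv => ?_
          rw [Set.uIoc_of_le hs.1] at hv
          exact (hfL _ _).trans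
            (mul_le_mul_of_nonneg_left (ih v ⟨hv.1.le, hv.2.trans hs.2⟩) hL)
      _ ≤ L * ((T * L) ^ k * M) * T := by
          rw [sub_zero, abs_of_nonneg hs.1]
          exact mul_le_mul_of_nonneg_left hs.2 (by positivity)
      _ = (T * L) ^ (k + 1) * M := by ring

end Picard

/-- the inductive step in the convergence analysis of the extended
Picard iteration. -/
theorem extended_picard_inductive_step {n : ℕ} (K r L T : ℝ) (hK : 1 ≤ K) (hr : 0 < r)
    (hL : 0 < L)
    (f : EuclideanSpace ℝ (Fin n) → EuclideanSpace ℝ (Fin n))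
    (hfL : ∀ y z : EuclideanSpace ℝ (Fin n), ‖f y - f z‖ ≤ L * ‖y - z‖)
    (hf0 : f 0 = 0)
    (φ : ℝ → EuclideanSpace ℝ (Fin n) → EuclideanSpace ℝ (Fin n))
    (hφ0 : ∀ x, φ 0 x = x)
    (hφd : ∀ x : EuclideanSpace ℝ (Fin n), ∀ t ≥ (0:ℝ),
      HasDerivAt (fun s => φ s x) (f (φ t x)) t)
    (hφsemi : ∀ t ≥ (0:ℝ), ∀ s ≥ (0:ℝ), ∀ x, φ (t + s) x = φ t (φ s x))
    (hφb : ∀ t ≥ (0:ℝ), ∀ y ∈ Metric.closedBall (0 : EuclideanSpace ℝ (Fin n)) (2 * K * r),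
      ‖φ t y‖ ≤ K * ‖y‖)
    (hT : 0 < T) (hTL : T * L < 1)
    (hTQ : T * sSup ((fun y => ‖f y‖) ''
      Metric.closedBall (0 : EuclideanSpace ℝ (Fin n)) (4 * K * r)) < 2 * K * r)
    (k : ℕ) (hk : 1 ≤ k)
    (x : EuclideanSpace ℝ (Fin n)) (hx : x ∈ Metric.closedBall (0 : EuclideanSpace ℝ (Fin n)) r)
    (i : ℕ) (hi : 1 ≤ i)
    (c : ℝ) (hc0 : 0 ≤ c) (hcK : c ≤ K)
    (hprev : ‖GIter f T k (i - 1) T x - φ (i * T) x‖ ≤ c * ‖x‖) :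
    ∀ t ∈ Set.Icc ((i : ℝ) * T) ((i : ℝ) * T + T),
      ‖GIter f T k i (t - i * T) x - φ t x‖ ≤
        ((Real.exp (T * L) + K * (T * L) ^ k) * c + K ^ 2 * (T * L) ^ k) * ‖x‖ := by
  have hfLip : LipschitzWith L.toNNReal f :=
    LipschitzWith.of_dist_le_mul fun y z => by
      simpa [dist_eq_norm, hL.le] using hfL y z
  rintro t ⟨hit, htT⟩
  obtain ⟨j, rfl⟩ : ∃ j, i = j + 1 := ⟨i - 1, by omega⟩
  set a : ℝ := ((j + 1 : ℕ) : ℝ) * T with ha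
  have ha0 : 0 ≤ a := by positivity
  set s := t - a with hs
  have hs0 : 0 ≤ s := sub_nonneg.2 hit
  have hsT : s ≤ T := by linarith
  rw [Nat.add_sub_cancel] at hprev
  change ‖(picardT f)^[k] 0 s (GIter f T k j T x) - φ t x‖ ≤ _
  set y := GIter f T k j T x
  have hφt : φ t x = φ s (φ a x) := by
    rw [← hφsemi s hs0 a ha0, hs, sub_add_cancel]
  rw [mem_closedBall_zero_iff] at hx
  have hφa : ‖φ a x‖ ≤ K * ‖x‖ :=
    hφb a ha0 x (mem_closedBall_zero_iff.2 (by nlinarith))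
  have hy : ‖y‖ ≤ (c + K) * ‖x‖ := by
    linarith [norm_le_norm_sub_add y (φ a x)]
  have hyr : ‖y‖ ≤ 2 * K * r :=
    hy.trans (mul_le_mul (by linarith) hx (norm_nonneg x) (by linarith))
  have hpic := norm_picardT_iterate_sub_le hL.le hfL hfLip.continuous (hφ0 y) (hφd y)
    (fun t ht => hφb t ht y (mem_closedBall_zero_iff.2 hyr)) k s ⟨hs0, hsT⟩
  have hgron : ‖φ s y - φ s (φ a x)‖ ≤ c * ‖x‖ * Real.exp (L * s) := by
    have h := dist_le_of_trajectories_ODE (v := fun _ => f) (K := L.toNNReal)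
      (f := fun v => φ v y) (g := fun v => φ v (φ a x)) (a := 0) (b := s) (δ := c * ‖x‖)
      (fun _ => hfLip)
      (fun v hv => (hφd y v hv.1).continuousAt.continuousWithinAt)
      (fun v hv => (hφd y v hv.1).hasDerivWithinAt)
      (fun v hv => (hφd _ v hv.1).continuousAt.continuousWithinAt)
      (fun v hv => (hφd _ v hv.1).hasDerivWithinAt)
      (by simpa only [hφ0, dist_eq_norm] using hprev) s ⟨hs0, le_rfl⟩
    simpa [dist_eq_norm, hL.le] using h
  rw [hφt]
  calc ‖(picardT f)^[k] 0 s y - φ s (φ a x)‖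
      ≤ ‖(picardT f)^[k] 0 s y - φ s y‖ + ‖φ s y - φ s (φ a x)‖ :=
        norm_sub_le_norm_sub_add_norm_sub _ _ _
    _ ≤ (T * L) ^ k * (K * ((c + K) * ‖x‖)) + c * ‖x‖ * Real.exp (T * L) := by
        refine add_le_add (hpic.trans (by gcongr)) (hgron.trans ?_)
        rw [mul_comm L s]
        gcongr
    _ = _ := by ring
end

section
/- Let n ∈ ℕ and let f : ℝⁿ → ℝⁿ be continuously differentiable with f(0) = 0. For k ≥ 1 define y_k(t,x) := (D_x(Pᵏ 0)(t,·))(x)[f(x)] − ∂/∂t (Pᵏ 0)(t,x), where D_x denotes the Fréchet derivative in the second argument. Then: (i) y₁(t,x) = f(x) for all t ∈ ℝ and x ∈ ℝⁿ; and (ii) for every integer k ≥ 2, every t ≥ 0, and every x ∈ ℝⁿ: y_k(t,x) = ∫₀ᵗ Df((P^{k−1} 0)(s,x))[y_{k−1}(s,x)] ds, where Df denotes the Fréchet derivative of f. -/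
/-- `y_k(t,x) = D_x(Pᵏ0)(t,·)(x)[f(x)] − ∂_t(Pᵏ0)(t,x)`. -/
noncomputable def ykFun {n : ℕ} (f : EuclideanSpace ℝ (Fin n) → EuclideanSpace ℝ (Fin n))
    (k : ℕ) (t : ℝ) (x : EuclideanSpace ℝ (Fin n)) : EuclideanSpace ℝ (Fin n) :=
  fderiv ℝ (fun x' => (picardT f)^[k] 0 t x') x (f x) -
    deriv (fun t' => (picardT f)^[k] 0 t' x) t

open MeasureTheory Set in
/-- Differentiation under an interval integral whose integrand is jointly continuous, with a jointly
continuous derivative in the parameter. -/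
theorem hasFDerivAt_intervalIntegral_of_continuous {H G : Type*}
    [NormedAddCommGroup H] [NormedSpace ℝ H] [ProperSpace H]
    [NormedAddCommGroup G] [NormedSpace ℝ G]
    {F : ℝ → H → G} {F' : ℝ → H → H →L[ℝ] G}
    (hF : Continuous (Function.uncurry F)) (hF' : Continuous (Function.uncurry F'))
    (hd : ∀ s x, HasFDerivAt (F s) (F' s x) x) (a b : ℝ) (x₀ : H) :
    HasFDerivAt (fun x => ∫ s in a..b, F s x) (∫ s in a..b, F' s x₀) x₀ := by
  obtain ⟨C, hC⟩ := (isCompact_uIcc.prod (isCompact_closedBall x₀ 1)).exists_bound_of_continuousOn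
    (s := uIcc a b ×ˢ Metric.closedBall x₀ 1) hF'.continuousOn
  have hFx (x : H) : Continuous fun s => F s x := hF.comp (by fun_prop : Continuous fun s => (s, x))
  have hF'x : Continuous fun s => F' s x₀ := hF'.comp (by fun_prop : Continuous fun s => (s, x₀))
  refine intervalIntegral.hasFDerivAt_integral_of_dominated_of_fderiv_le
    (F := fun x s => F s x) (F' := fun x s => F' s x) (bound := fun _ => C)
    (Metric.closedBall_mem_nhds x₀ one_pos)
    (.of_forall fun x => (hFx x).aestronglyMeasurable) ((hFx x₀).intervalIntegrable a b)
    hF'x.aestronglyMeasurable ?_ intervalIntegrable_const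
    (.of_forall fun s _ x _ => hd s x)
  exact .of_forall fun s hs x hx => hC (s, x) ⟨uIoc_subset_uIcc hs, hx⟩

section Picard

variable {n : ℕ} {f : EuclideanSpace ℝ (Fin n) → EuclideanSpace ℝ (Fin n)}
  {z : ℝ → EuclideanSpace ℝ (Fin n) → EuclideanSpace ℝ (Fin n)}

/-- Joint continuity, together with differentiability in space with a jointly continuous
derivative. -/
structure IsSpatiallyC1
    (z : ℝ → EuclideanSpace ℝ (Fin n) → EuclideanSpace ℝ (Fin n)) : Prop where
  continuous_uncurry : Continuous (Function.uncurry z)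
  differentiable (t : ℝ) : Differentiable ℝ (z t)
  continuous_fderiv : Continuous (Function.uncurry fun t x => fderiv ℝ (z t) x)

theorem isSpatiallyC1_zero :
    IsSpatiallyC1 (0 : ℝ → EuclideanSpace ℝ (Fin n) → EuclideanSpace ℝ (Fin n)) where
  continuous_uncurry := continuous_const
  differentiable _ := differentiable_const 0
  continuous_fderiv := by
    simpa [Function.uncurry_def] using continuous_const

theorem continuous_fderiv_comp (hf : ContDiff ℝ 1 f) (hz : IsSpatiallyC1 z) :
    Continuous (Function.uncurry fun s x => (fderiv ℝ f (z s x)).comp (fderiv ℝ (z s) x)) :=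
  ((hf.continuous_fderiv one_ne_zero).comp hz.continuous_uncurry).clm_comp hz.continuous_fderiv

theorem hasFDerivAt_picardT (hf : ContDiff ℝ 1 f) (hz : IsSpatiallyC1 z)
    (t : ℝ) (x : EuclideanSpace ℝ (Fin n)) :
    HasFDerivAt (picardT f z t)
      (ContinuousLinearMap.id ℝ _ +
        ∫ s in (0:ℝ)..t, (fderiv ℝ f (z s x)).comp (fderiv ℝ (z s) x)) x :=
  (hasFDerivAt_id x).add <| hasFDerivAt_intervalIntegral_of_continuous
    (F := fun s y => f (z s y)) (hf.continuous.comp hz.continuous_uncurry) (continuous_fderiv_comp hf hz)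
    (fun s y => ((hf.differentiable one_ne_zero _).hasFDerivAt).comp y
      (hz.differentiable s y).hasFDerivAt) 0 t x

theorem IsSpatiallyC1.picardT (hf : ContDiff ℝ 1 f) (hz : IsSpatiallyC1 z) :
    IsSpatiallyC1 (picardT f z) where
  continuous_uncurry := continuous_snd.add <|
    intervalIntegral.continuous_parametric_intervalIntegral_of_continuous
      (f := fun (p : ℝ × EuclideanSpace ℝ (Fin n)) s => f (z s p.2))
      ((hf.continuous.comp hz.continuous_uncurry).comp
        (by fun_prop : Continuous fun q : (ℝ × EuclideanSpace ℝ (Fin n)) × ℝ => (q.2, q.1.2)))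
      continuous_fst
  differentiable t x := (hasFDerivAt_picardT hf hz t x).differentiableAt
  continuous_fderiv := by
    simp only [(hasFDerivAt_picardT hf hz _ _).fderiv]
    exact continuous_const.add <|
      intervalIntegral.continuous_parametric_intervalIntegral_of_continuous
        (f := fun (p : ℝ × EuclideanSpace ℝ (Fin n)) s =>
          (fderiv ℝ f (z s p.2)).comp (fderiv ℝ (z s) p.2))
        ((continuous_fderiv_comp hf hz).comp
          (by fun_prop : Continuous fun q : (ℝ × EuclideanSpace ℝ (Fin n)) × ℝ => (q.2, q.1.2)))
        continuous_fst

theorem hasDerivAt_picardT (hf : Continuous f) (hz : Continuous (Function.uncurry z))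
    (t : ℝ) (x : EuclideanSpace ℝ (Fin n)) :
    HasDerivAt (fun t => picardT f z t x) (f (z t x)) t :=
  ((hf.comp (hz.comp (by fun_prop : Continuous fun s : ℝ => (s, x)))).integral_hasStrictDerivAt
    0 t).hasDerivAt.const_add x

theorem picardT_residual (hf : ContDiff ℝ 1 f) (hz : IsSpatiallyC1 z)
    (t : ℝ) (x : EuclideanSpace ℝ (Fin n)) :
    fderiv ℝ (picardT f (picardT f z) t) x (f x) -
        deriv (fun s => picardT f (picardT f z) s x) t =
      ∫ s in (0:ℝ)..t, fderiv ℝ f (picardT f z s x)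
        (fderiv ℝ (picardT f z s) x (f x) - deriv (fun s => picardT f z s x) s) := by
  have hw := hz.picardT hf
  have hx : Continuous fun s : ℝ => (s, x) := by fun_prop
  have hA : Continuous fun s =>
      (fderiv ℝ f (picardT f z s x)).comp (fderiv ℝ (picardT f z s) x) :=
    (continuous_fderiv_comp hf hw).comp hx
  have hAf : Continuous fun s =>
      fderiv ℝ f (picardT f z s x) (fderiv ℝ (picardT f z s) x (f x)) :=
    hA.clm_apply continuous_const
  have hB : Continuous fun s => fderiv ℝ f (picardT f z s x) (f (z s x)) :=
    ((hf.continuous_fderiv one_ne_zero).comp (hw.continuous_uncurry.comp hx)).clm_apply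
      (hf.continuous.comp (hz.continuous_uncurry.comp hx))
  have hFTC : ∫ s in (0:ℝ)..t, fderiv ℝ f (picardT f z s x) (f (z s x)) =
      f (picardT f z t x) - f x := by
    rw [intervalIntegral.integral_eq_sub_of_hasDerivAt (f := fun s => f (picardT f z s x))
      (fun s _ => (hf.differentiable one_ne_zero _).hasFDerivAt.comp_hasDerivAt s
        (hasDerivAt_picardT hf.continuous hz.continuous_uncurry s x)) (hB.intervalIntegrable 0 t)]
    simp [picardT]
  simp only [(hasDerivAt_picardT hf.continuous hz.continuous_uncurry _ x).deriv, map_sub]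
  rw [(hasFDerivAt_picardT hf hw t x).fderiv,
    (hasDerivAt_picardT hf.continuous hw.continuous_uncurry t x).deriv,
    intervalIntegral.integral_sub (hAf.intervalIntegrable 0 t)
      (hB.intervalIntegrable 0 t), hFTC, add_apply,
    ContinuousLinearMap.intervalIntegral_apply (hA.intervalIntegrable 0 t)]
  simp only [ContinuousLinearMap.id_apply, ContinuousLinearMap.comp_apply]
  abel

theorem isSpatiallyC1_picardT_iterate (hf : ContDiff ℝ 1 f) (k : ℕ) :
    IsSpatiallyC1 ((picardT f)^[k] 0) := by
  induction k with
  | zero => exact isSpatiallyC1_zero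
  | succ k ih => simpa only [Function.iterate_succ_apply'] using ih.picardT hf

end Picard

/-- the recursion satisfied by `y_k`:
`y₁(t,x) = f(x)` and `y_k(t,x) = ∫₀ᵗ Df((P^{k−1}0)(s,x))[y_{k−1}(s,x)] ds` for `k ≥ 2`. -/
theorem yk_recursion {n : ℕ}
    (f : EuclideanSpace ℝ (Fin n) → EuclideanSpace ℝ (Fin n))
    (hf : ContDiff ℝ 1 f) (hf0 : f 0 = 0) :
    (∀ (t : ℝ) (x : EuclideanSpace ℝ (Fin n)), ykFun f 1 t x = f x) ∧
    ∀ k : ℕ, 2 ≤ k → ∀ t ≥ (0:ℝ), ∀ x : EuclideanSpace ℝ (Fin n),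
      ykFun f k t x =
        ∫ s in (0:ℝ)..t, fderiv ℝ f ((picardT f)^[k-1] 0 s x) (ykFun f (k-1) s x) := by
  refine ⟨fun t x => ?_, fun k hk t _ x => ?_⟩
  · simp [ykFun, picardT, hf0]
  · obtain ⟨m, rfl⟩ := Nat.exists_eq_add_of_le' hk
    simpa only [ykFun, Nat.add_sub_cancel, Nat.reduceSubDiff, Function.iterate_succ_apply'] using
      picardT_residual hf (isSpatiallyC1_picardT_iterate hf m) t x
end

section
/- Let n, m ∈ ℕ, let a ≤ b be real numbers, and let g₁,…,g_m be real polynomials in the n+1 variables (s, x₁,…,xₙ). Then there exists a polynomial V ∈ ℝ[x₁,…,xₙ] which is a sum of squares of polynomials, such that for every x ∈ ℝⁿ: V(x) = ∫_a^b Σ_{j=1}^m gⱼ(s,x)² ds. -/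
open scoped MatrixOrder in
/-- The Gram form of the monomials `1, s, …, s ^ (d - 1)` in `L²[a,b]` is a sum of squares of
linear forms. -/
theorem exists_integral_sq_eq_sum_sq (d : ℕ) {a b : ℝ} (hab : a ≤ b) :
    ∃ B : Matrix (Fin d) (Fin d) ℝ, ∀ c : Fin d → ℝ,
      ∫ s in a..b, (∑ k, c k * s ^ (k : ℕ)) ^ 2 = ∑ i, (∑ k, B i k * c k) ^ 2 := by
  let M : Matrix (Fin d) (Fin d) ℝ := fun k l => ∫ s in a..b, s ^ (k : ℕ) * s ^ (l : ℕ)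
  have hM (c : Fin d → ℝ) :
      ∫ s in a..b, (∑ k, c k * s ^ (k : ℕ)) ^ 2 = c ⬝ᵥ M.mulVec c := by
    have h (s : ℝ) : (∑ k, c k * s ^ (k : ℕ)) ^ 2 =
        ∑ k, ∑ l, (c k * c l) * (s ^ (k : ℕ) * s ^ (l : ℕ)) := by
      rw [sq, Finset.sum_mul_sum]
      exact Finset.sum_congr rfl fun k _ => Finset.sum_congr rfl fun l _ => by ring
    simp_rw [h, dotProduct, Matrix.mulVec, dotProduct, Finset.mul_sum]
    rw [intervalIntegral.integral_finsetSum
      fun k _ => Continuous.intervalIntegrable (by fun_prop) _ _]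
    refine Finset.sum_congr rfl fun k _ => ?_
    rw [intervalIntegral.integral_finsetSum
      fun l _ => Continuous.intervalIntegrable (by fun_prop) _ _]
    refine Finset.sum_congr rfl fun l _ => ?_
    rw [intervalIntegral.integral_const_mul]
    ring
  have hpos : M.PosSemidef := by
    refine Matrix.PosSemidef.of_dotProduct_mulVec_nonneg ?_ fun c => ?_
    · ext k l
      rw [Matrix.conjTranspose_apply]
      simp only [M, star_trivial, mul_comm]
    · rw [star_trivial, ← hM]
      exact intervalIntegral.integral_nonneg hab fun s _ => sq_nonneg _
  obtain ⟨B, hB⟩ := CStarAlgebra.nonneg_iff_eq_star_mul_self.mp hpos.nonneg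
  refine ⟨B, fun c => ?_⟩
  rw [hM, hB, Matrix.star_eq_conjTranspose, Matrix.conjTranspose_eq_transpose_of_trivial,
    ← Matrix.mulVec_mulVec, Matrix.dotProduct_mulVec, Matrix.vecMul_transpose]
  simp [dotProduct, Matrix.mulVec, sq]

/-- integrating out the first variable of a sum of squares of polynomials
in `(s, x₁,…,xₙ)` over `s ∈ [a,b]` yields a sum-of-squares polynomial in `x₁,…,xₙ`. -/
theorem integral_of_sos_is_sos (n m : ℕ) (a b : ℝ) (hab : a ≤ b)
    (g : Fin m → MvPolynomial (Fin (n + 1)) ℝ) :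
    ∃ V : MvPolynomial (Fin n) ℝ,
      (∃ (N : ℕ) (h : Fin N → MvPolynomial (Fin n) ℝ), V = ∑ j, (h j) ^ 2) ∧
      ∀ x : Fin n → ℝ,
        MvPolynomial.eval x V =
          ∫ s in a..b, ∑ j, (MvPolynomial.eval (Fin.cons s x) (g j)) ^ 2 := by
  let p (j : Fin m) := MvPolynomial.finSuccEquiv ℝ n (g j)
  let d (j : Fin m) : ℕ := (p j).natDegree + 1
  choose B hB using fun j => exists_integral_sq_eq_sum_sq (d j) hab
  let q : (Σ j, Fin (d j)) → MvPolynomial (Fin n) ℝ := fun i =>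
    ∑ k, MvPolynomial.C (B i.1 i.2 k) * (p i.1).coeff k
  have heval (j : Fin m) (x : Fin n → ℝ) (s : ℝ) : MvPolynomial.eval (Fin.cons s x) (g j) =
      ∑ k : Fin (d j), MvPolynomial.eval x ((p j).coeff k) * s ^ (k : ℕ) := by
    rw [MvPolynomial.eval_eq_eval_mv_eval', Polynomial.eval_map, Polynomial.eval₂_eq_sum_range,
      Finset.sum_range]
  refine ⟨∑ i, q i ^ 2, ⟨Fintype.card (Σ j, Fin (d j)),
    q ∘ (Fintype.equivFin _).symm, ?_⟩, fun x => ?_⟩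
  · exact (Equiv.sum_comp (Fintype.equivFin _).symm fun i => q i ^ 2).symm
  · simp_rw [heval]
    rw [intervalIntegral.integral_finsetSum
      fun j _ => Continuous.intervalIntegrable (by fun_prop) _ _]
    simp [hB, q, Fintype.sum_sigma]
end

section
/- Let n, q ∈ ℕ with q ≥ 1, and let f : ℝⁿ → ℝⁿ be such that each component fᵢ is given by evaluation of a real polynomial in x₁,…,xₙ of total degree at most q. Then for every integer k ≥ 1 there exist polynomials p₁,…,pₙ ∈ ℝ[t, x₁,…,xₙ] whose total degree in the variables x₁,…,xₙ is at most q^{k−1}, such that for all t ∈ ℝ and x ∈ ℝⁿ and each i: ((Pᵏ 0)(t,x))ᵢ = pᵢ(t,x). -/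
namespace MvPolynomial

/-- The polynomials in `ℝ[t,x₁,…,xₙ]` of total degree at most `d` in `x₁,…,xₙ`, where the
variable `0` is `t` and the variable `j.succ` is `xⱼ`. -/
noncomputable def spatialDegreeLE (n d : ℕ) : Submodule ℝ (MvPolynomial (Fin (n + 1)) ℝ) :=
  restrictSupport ℝ {m | ∑ j : Fin n, m j.succ ≤ d}

variable {n : ℕ}

lemma spatialDegreeLE_mono {d e : ℕ} (h : d ≤ e) : spatialDegreeLE n d ≤ spatialDegreeLE n e :=
  restrictSupport_mono ℝ fun _ hm => le_trans hm h

lemma one_mem_spatialDegreeLE (d : ℕ) : 1 ∈ spatialDegreeLE n d :=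
  (monomial_mem_restrictSupport ℝ).mpr (Or.inl (by simp))

lemma X_succ_mem_spatialDegreeLE (i : Fin n) : X i.succ ∈ spatialDegreeLE n 1 :=
  (monomial_mem_restrictSupport ℝ).mpr (Or.inl (by simp [Finsupp.single_apply]))

lemma mul_mem_spatialDegreeLE {d e : ℕ} {p r : MvPolynomial (Fin (n + 1)) ℝ}
    (hp : p ∈ spatialDegreeLE n d) (hr : r ∈ spatialDegreeLE n e) :
    p * r ∈ spatialDegreeLE n (d + e) := by
  classical
  intro m hm
  obtain ⟨a, ha, b, hb, rfl⟩ := Finset.mem_add.mp (support_mul p r hm)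
  simpa [Finset.sum_add_distrib] using add_le_add (hp ha) (hr hb)

lemma pow_mem_spatialDegreeLE {d : ℕ} {p : MvPolynomial (Fin (n + 1)) ℝ}
    (hp : p ∈ spatialDegreeLE n d) (a : ℕ) : p ^ a ∈ spatialDegreeLE n (a * d) := by
  induction a with
  | zero => simpa using one_mem_spatialDegreeLE 0
  | succ a ih =>
    rw [pow_succ, Nat.succ_mul]
    exact mul_mem_spatialDegreeLE ih hp

lemma prod_mem_spatialDegreeLE {ι : Type*} (s : Finset ι) {d : ι → ℕ}
    {p : ι → MvPolynomial (Fin (n + 1)) ℝ} (hp : ∀ i ∈ s, p i ∈ spatialDegreeLE n (d i)) :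
    ∏ i ∈ s, p i ∈ spatialDegreeLE n (∑ i ∈ s, d i) := by
  classical
  induction s using Finset.induction_on with
  | empty => simpa using one_mem_spatialDegreeLE 0
  | insert i s his ih =>
    rw [Finset.prod_insert his, Finset.sum_insert his]
    exact mul_mem_spatialDegreeLE (hp i (Finset.mem_insert_self i s))
      (ih fun j hj => hp j (Finset.mem_insert_of_mem hj))

lemma bind₁_mem_spatialDegreeLE {σ : Type*} {d q : ℕ}
    {p : σ → MvPolynomial (Fin (n + 1)) ℝ} (hp : ∀ i, p i ∈ spatialDegreeLE n d)
    {F : MvPolynomial σ ℝ} (hF : F.totalDegree ≤ q) :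
    bind₁ p F ∈ spatialDegreeLE n (q * d) := by
  rw [F.as_sum, map_sum]
  refine Submodule.sum_mem _ fun m hm => ?_
  rw [bind₁_monomial, ← smul_eq_C_mul]
  refine Submodule.smul_mem _ _ (spatialDegreeLE_mono ?_
    (prod_mem_spatialDegreeLE m.support fun i _ => pow_mem_spatialDegreeLE (hp i) (m i)))
  rw [← Finset.sum_mul]
  exact Nat.mul_le_mul_right d ((le_totalDegree hm).trans hF)

/-- The antiderivative in the variable `0` that vanishes where this variable is zero. -/
noncomputable def antiderivZero (p : MvPolynomial (Fin (n + 1)) ℝ) :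
    MvPolynomial (Fin (n + 1)) ℝ :=
  ∑ m ∈ p.support, monomial (m + Finsupp.single 0 1) (p.coeff m / (m 0 + 1))

lemma antiderivZero_mem_spatialDegreeLE {d : ℕ} {p : MvPolynomial (Fin (n + 1)) ℝ}
    (hp : p ∈ spatialDegreeLE n d) : antiderivZero p ∈ spatialDegreeLE n d :=
  Submodule.sum_mem _ fun m hm =>
    (monomial_mem_restrictSupport ℝ).mpr (Or.inl (by simpa using hp hm))

lemma continuous_eval_cons (p : MvPolynomial (Fin (n + 1)) ℝ) (x : Fin n → ℝ) :
    Continuous fun s : ℝ => eval (Fin.cons s x : Fin (n + 1) → ℝ) p :=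
  (continuous_eval p).comp (Continuous.finCons (A := fun _ => ℝ) continuous_id continuous_const)

lemma integral_eval_cons (p : MvPolynomial (Fin (n + 1)) ℝ) (t : ℝ) (x : Fin n → ℝ) :
    ∫ s in (0 : ℝ)..t, eval (Fin.cons s x : Fin (n + 1) → ℝ) p =
      eval (Fin.cons t x : Fin (n + 1) → ℝ) (antiderivZero p) := by
  have hmono (m : Fin (n + 1) →₀ ℕ) (c s : ℝ) :
      eval (Fin.cons s x : Fin (n + 1) → ℝ) (monomial m c) =
        c * (s ^ m 0 * ∏ j : Fin n, x j ^ m j.succ) := by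
    rw [eval_monomial, Finsupp.prod_fintype _ _ (by simp), Fin.prod_univ_succ]
    simp
  have hsum (s : ℝ) : eval (Fin.cons s x : Fin (n + 1) → ℝ) p =
      ∑ m ∈ p.support, eval (Fin.cons s x : Fin (n + 1) → ℝ) (monomial m (p.coeff m)) := by
    rw [← map_sum, ← p.as_sum]
  simp_rw [hsum]
  rw [intervalIntegral.integral_finsetSum fun m _ =>
    (continuous_eval_cons _ x).intervalIntegrable 0 t, antiderivZero, map_sum]
  refine Finset.sum_congr rfl fun m _ => ?_
  simp only [hmono, intervalIntegral.integral_const_mul, intervalIntegral.integral_mul_const,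
    integral_pow]
  simp
  ring

end MvPolynomial

open MvPolynomial in
/-- The Picard operator of a polynomial map preserves polynomial functions of `(t,x)`. -/
lemma picardT_apply_eq_eval {n : ℕ}
    {f : EuclideanSpace ℝ (Fin n) → EuclideanSpace ℝ (Fin n)}
    {F : Fin n → MvPolynomial (Fin n) ℝ}
    (hf : ∀ (x : EuclideanSpace ℝ (Fin n)) (i : Fin n), f x i = eval (fun j => x j) (F i))
    {z : ℝ → EuclideanSpace ℝ (Fin n) → EuclideanSpace ℝ (Fin n)}
    {p : Fin n → MvPolynomial (Fin (n + 1)) ℝ}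
    (hz : ∀ (t : ℝ) (x : EuclideanSpace ℝ (Fin n)) (i : Fin n),
      z t x i = eval (Fin.cons t (fun j => x j)) (p i))
    (t : ℝ) (x : EuclideanSpace ℝ (Fin n)) (i : Fin n) :
    picardT f z t x i =
      eval (Fin.cons t (fun j => x j)) (X i.succ + antiderivZero (bind₁ p (F i))) := by
  have hcomp (s : ℝ) (j : Fin n) :
      f (z s x) j = eval (Fin.cons s (fun j => x j)) (bind₁ p (F j)) := by
    simp only [hf, hz]
    exact (eval₂Hom_bind₁ _ _ _ _).symm
  have hcont : Continuous fun s => f (z s x) := by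
    refine (PiLp.continuous_toLp 2 fun _ : Fin n => ℝ).comp (continuous_pi fun j => ?_)
    simpa only [hcomp] using continuous_eval_cons (bind₁ p (F j)) fun j => x j
  have hint := (EuclideanSpace.proj (𝕜 := ℝ) i).intervalIntegral_comp_comm
    (hcont.intervalIntegrable (μ := MeasureTheory.volume) 0 t)
  simp only [EuclideanSpace.coe_proj] at hint
  simp only [picardT, PiLp.add_apply, map_add, eval_X, Fin.cons_succ, ← integral_eval_cons,
    ← hcomp, hint]

/-- if `f` is polynomial of degree at most `q ≥ 1`, then `Pᵏ 0` is polynomial in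
`(t,x)` of degree at most `q^{k−1}` in the spatial variables `x₁,…,xₙ`.  Here the variable `0`
of `ℝ[t,x₁,…,xₙ]` is `t` and the variable `j.succ` is `xⱼ`. -/
theorem picard_iterate_polynomial_degree {n q : ℕ} (hq : 1 ≤ q)
    (f : EuclideanSpace ℝ (Fin n) → EuclideanSpace ℝ (Fin n))
    (F : Fin n → MvPolynomial (Fin n) ℝ)
    (hdeg : ∀ i, (F i).totalDegree ≤ q)
    (hf : ∀ (x : EuclideanSpace ℝ (Fin n)) (i : Fin n),
      f x i = MvPolynomial.eval (fun j => x j) (F i)) :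
    ∀ k : ℕ, 1 ≤ k →
      ∃ p : Fin n → MvPolynomial (Fin (n + 1)) ℝ,
        (∀ i : Fin n, ∀ mo ∈ (p i).support, (∑ j : Fin n, mo j.succ) ≤ q ^ (k - 1)) ∧
        ∀ (t : ℝ) (x : EuclideanSpace ℝ (Fin n)) (i : Fin n),
          (picardT f)^[k] 0 t x i =
            MvPolynomial.eval (Fin.cons t (fun j => x j)) (p i) := by
  have key (k : ℕ) : ∃ p : Fin n → MvPolynomial (Fin (n + 1)) ℝ,
      (∀ i, p i ∈ MvPolynomial.spatialDegreeLE n (q ^ k)) ∧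
      ∀ (t : ℝ) (x : EuclideanSpace ℝ (Fin n)) (i : Fin n),
        (picardT f)^[k + 1] 0 t x i =
          MvPolynomial.eval (Fin.cons t (fun j => x j)) (p i) := by
    have step {d e : ℕ} (he : 1 ≤ e) (hde : q * d ≤ e)
        {p : Fin n → MvPolynomial (Fin (n + 1)) ℝ}
        (hp : ∀ i, p i ∈ MvPolynomial.spatialDegreeLE n d) (i : Fin n) :
        MvPolynomial.X i.succ + (MvPolynomial.bind₁ p (F i)).antiderivZero ∈
          MvPolynomial.spatialDegreeLE n e :=
      Submodule.add_mem _
        (MvPolynomial.spatialDegreeLE_mono he (MvPolynomial.X_succ_mem_spatialDegreeLE i))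
        (MvPolynomial.antiderivZero_mem_spatialDegreeLE (MvPolynomial.spatialDegreeLE_mono hde
          (MvPolynomial.bind₁_mem_spatialDegreeLE hp (hdeg i))))
    induction k with
    | zero =>
      exact ⟨_, step (d := 0) (p := 0) (by simp) (by simp) fun _ => Submodule.zero_mem _,
        picardT_apply_eq_eval hf (z := 0) (by simp)⟩
    | succ k ih =>
      obtain ⟨p, hp, hz⟩ := ih
      refine ⟨_, step (Nat.one_le_pow _ _ hq) (pow_succ' q k).ge hp, ?_⟩
      rw [Function.iterate_succ_apply']
      exact picardT_apply_eq_eval hf hz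
  rintro (_ | k) hk
  · omega
  · exact key k
end

section
/- Let n, q ∈ ℕ with q ≥ 1, and let f : ℝⁿ → ℝⁿ be such that each component fᵢ is given by a real polynomial in x₁,…,xₙ of total degree at most q. Let φ be a global solution map of ẋ = f(x). Let K ≥ 1, λ > 0, r > 0, let M ⊆ B_r be nonempty, and suppose ‖φ(t,x)‖ ≤ K‖x‖·e^{−λt} for all t ≥ 0 and all x ∈ B_{2Kr}. Let L > 0 be a Lipschitz constant for f on B_{4Kr}. Suppose T > 0 and N ∈ ℕ satisfy N·T > log(2K²)/(2λ) and T < 1/(2L), and suppose k ∈ ℕ is such that c(k) < K, c(k)² + (log(2K²)/(2λ))·K·((TL)ᵏ/T)·(1+c(k))·(K+c(k)) < 1/2, and c(k)² < (λ/(K·L·log(2K²)))·(1 − (2K²)^{−L/λ}). Then there exist α, β, γ > 0 and a polynomial V ∈ ℝ[x₁,…,xₙ] which is a sum of squares of polynomials, with total degree at most 2·q^{Nk−1}, such that for all x ∈ M: α‖x‖² ≤ V(x) ≤ β‖x‖² and Σ_{i=1}^n (∂V/∂xᵢ)(x)·fᵢ(x) ≤ −γ‖x‖². -/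
/-- `c(k) = Σ_{i=0}^{N−1} (e^{TL} + K·(TL)ᵏ)ⁱ · K² · (TL)ᵏ`. -/
noncomputable def cval (K T L : ℝ) (N k : ℕ) : ℝ :=
  ∑ i ∈ Finset.range N, (Real.exp (T * L) + K * (T * L) ^ k) ^ i * (K ^ 2 * (T * L) ^ k)

namespace ConverseSOS

open MvPolynomial

variable {σ : Type*}

/-- Chain rule for a derivation applied to a polynomial expression. -/
theorem derivation_aeval [Fintype σ] {S : Type*} [CommRing S] [Algebra ℝ S]
    (d : Derivation ℝ S S) (g : σ → S) (p : MvPolynomial σ ℝ) :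
    d (aeval g p) = ∑ j, aeval g (pderiv j p) * d (g j) := by
  classical
  induction p using MvPolynomial.induction_on with
  | C a => simp [algHom_C]
  | add p q hp hq => simp [hp, hq, add_mul, Finset.sum_add_distrib]
  | mul_X p i hp =>
    simp only [map_mul, aeval_X, Derivation.leibniz, smul_eq_mul, hp, pderiv_X, map_add,
      add_mul, Finset.sum_add_distrib, Finset.mul_sum]
    congr 1
    · rw [Finset.sum_eq_single i]
      · simp
      · intro j _ hj
        simp [hj.symm]
      · simp
    · exact Finset.sum_congr rfl fun j _ => by ring

/-- The extension of a derivation to univariate polynomials, acting on coefficients. -/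
noncomputable def coeffwise (d : Derivation ℝ (MvPolynomial σ ℝ) (MvPolynomial σ ℝ)) :
    Derivation ℝ (Polynomial (MvPolynomial σ ℝ)) (Polynomial (MvPolynomial σ ℝ)) :=
  (PolynomialModule.equivPolynomialSelf (R := MvPolynomial σ ℝ)).toLinearMap.compDer d.mapCoeffs

theorem coeff_coeffwise (d : Derivation ℝ (MvPolynomial σ ℝ) (MvPolynomial σ ℝ))
    (P : Polynomial (MvPolynomial σ ℝ)) (k : ℕ) :
    (coeffwise d P).coeff k = d (P.coeff k) := rfl

theorem derivative_coeffwise (d : Derivation ℝ (MvPolynomial σ ℝ) (MvPolynomial σ ℝ))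
    (P : Polynomial (MvPolynomial σ ℝ)) :
    Polynomial.derivative (coeffwise d P) = coeffwise d (Polynomial.derivative P) := by
  ext1 k
  simp only [Polynomial.coeff_derivative, coeff_coeffwise, Derivation.leibniz, smul_eq_mul, map_add,
    Derivation.map_natCast, Derivation.map_one_eq_zero]
  ring

/-- Evaluation at a real constant commutes with coefficientwise derivation. -/
theorem eval_coeffwise (d : Derivation ℝ (MvPolynomial σ ℝ) (MvPolynomial σ ℝ))
    (P : Polynomial (MvPolynomial σ ℝ)) (T : ℝ) :
    (coeffwise d P).eval (C T) = d (P.eval (C T)) := by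
  induction P using Polynomial.induction_on' with
  | add P Q hP hQ => simp [hP, hQ]
  | monomial k a =>
    have h : coeffwise d (Polynomial.monomial k a) = Polynomial.monomial k (d a) := by
      ext1 j
      rw [coeff_coeffwise, Polynomial.coeff_monomial, Polynomial.coeff_monomial]
      split_ifs <;> simp
    rw [h, Polynomial.eval_monomial, Polynomial.eval_monomial, ← C_pow, Derivation.leibniz,
      derivation_C, smul_zero, zero_add, smul_eq_mul, mul_comm]

/-- The antiderivative with vanishing constant coefficient. -/
noncomputable def antideriv (P : Polynomial (MvPolynomial σ ℝ)) :
    Polynomial (MvPolynomial σ ℝ) :=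
  P.sum fun k a => Polynomial.monomial (k + 1) (((k : ℝ) + 1)⁻¹ • a)

theorem antideriv_add (P Q : Polynomial (MvPolynomial σ ℝ)) :
    antideriv (P + Q) = antideriv P + antideriv Q := by
  unfold antideriv
  rw [Polynomial.sum_add_index]
  · simp
  · simp

theorem antideriv_monomial (k : ℕ) (a : MvPolynomial σ ℝ) :
    antideriv (Polynomial.monomial k a) =
      Polynomial.monomial (k + 1) (((k : ℝ) + 1)⁻¹ • a) := by
  unfold antideriv
  rw [Polynomial.sum_monomial_index]
  simp

theorem derivative_antideriv (P : Polynomial (MvPolynomial σ ℝ)) :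
    Polynomial.derivative (antideriv P) = P := by
  induction P using Polynomial.induction_on' with
  | add P Q hP hQ => simp [antideriv_add, hP, hQ]
  | monomial k a =>
    rw [antideriv_monomial, Polynomial.derivative_monomial]
    congr 1
    have h : ((k : ℝ) + 1) ≠ 0 := by positivity
    have h2 : ((k + 1 : ℕ) : MvPolynomial σ ℝ) = C ((k : ℝ) + 1) := by simp
    rw [h2, smul_eq_C_mul, mul_comm, ← mul_assoc, ← C_mul, mul_inv_cancel₀ h]
    simp

theorem coeff_antideriv_zero (P : Polynomial (MvPolynomial σ ℝ)) :
    (antideriv P).coeff 0 = 0 := by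
  induction P using Polynomial.induction_on' with
  | add P Q hP hQ => simp [antideriv_add, hP, hQ]
  | monomial k a => simp [antideriv_monomial, Polynomial.coeff_monomial]

theorem coeff_antideriv_succ (P : Polynomial (MvPolynomial σ ℝ)) (k : ℕ) :
    (antideriv P).coeff (k + 1) = ((k : ℝ) + 1)⁻¹ • P.coeff k := by
  induction P using Polynomial.induction_on' with
  | add P Q hP hQ => simp [antideriv_add, hP, hQ]
  | monomial j a =>
    rw [antideriv_monomial, Polynomial.coeff_monomial, Polynomial.coeff_monomial]
    by_cases h : j = k <;> simp [h]

/-- All coefficients have total degree at most `d`. -/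
def CoeffDegreeLE (P : Polynomial (MvPolynomial σ ℝ)) (d : ℕ) : Prop :=
  ∀ k, (P.coeff k).totalDegree ≤ d

theorem CoeffDegreeLE.mono {P : Polynomial (MvPolynomial σ ℝ)} {d e : ℕ}
    (h : CoeffDegreeLE P d) (hde : d ≤ e) : CoeffDegreeLE P e := fun k => (h k).trans hde

theorem CoeffDegreeLE.add {P Q : Polynomial (MvPolynomial σ ℝ)} {d : ℕ}
    (hP : CoeffDegreeLE P d) (hQ : CoeffDegreeLE Q d) : CoeffDegreeLE (P + Q) d := fun k => by
  rw [Polynomial.coeff_add]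
  exact (totalDegree_add _ _).trans (max_le (hP k) (hQ k))

theorem CoeffDegreeLE.sum {ι : Type*} {s : Finset ι} {P : ι → Polynomial (MvPolynomial σ ℝ)}
    {d : ℕ} (hP : ∀ i ∈ s, CoeffDegreeLE (P i) d) : CoeffDegreeLE (∑ i ∈ s, P i) d := fun k => by
  rw [Polynomial.finsetSum_coeff]
  exact totalDegree_finsetSum_le fun i hi => hP i hi k

theorem CoeffDegreeLE.smul {P : Polynomial (MvPolynomial σ ℝ)} {d : ℕ} (a : ℝ)
    (hP : CoeffDegreeLE P d) : CoeffDegreeLE (a • P) d := fun k => by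
  rw [Polynomial.coeff_smul]
  exact (totalDegree_smul_le _ _).trans (hP k)

theorem CoeffDegreeLE.mul {P Q : Polynomial (MvPolynomial σ ℝ)} {d e : ℕ}
    (hP : CoeffDegreeLE P d) (hQ : CoeffDegreeLE Q e) : CoeffDegreeLE (P * Q) (d + e) := fun k => by
  rw [Polynomial.coeff_mul]
  exact totalDegree_finsetSum_le fun i _ =>
    (totalDegree_mul _ _).trans (add_le_add (hP _) (hQ _))

theorem CoeffDegreeLE.one : CoeffDegreeLE (1 : Polynomial (MvPolynomial σ ℝ)) 0 := fun k => by
  rw [Polynomial.coeff_one]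
  split_ifs <;> simp

theorem CoeffDegreeLE.pow {P : Polynomial (MvPolynomial σ ℝ)} {d : ℕ}
    (hP : CoeffDegreeLE P d) (m : ℕ) : CoeffDegreeLE (P ^ m) (m * d) := by
  induction m with
  | zero => simpa using CoeffDegreeLE.one
  | succ m ih =>
    rw [pow_succ, Nat.succ_mul]
    exact ih.mul hP

theorem CoeffDegreeLE.prod {ι : Type*} {s : Finset ι} {P : ι → Polynomial (MvPolynomial σ ℝ)}
    {d : ι → ℕ} (hP : ∀ i ∈ s, CoeffDegreeLE (P i) (d i)) :
    CoeffDegreeLE (∏ i ∈ s, P i) (∑ i ∈ s, d i) := by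
  classical
  induction s using Finset.induction_on with
  | empty => simpa using CoeffDegreeLE.one
  | insert a s ha ih =>
    rw [Finset.prod_insert ha, Finset.sum_insert ha]
    exact (hP a (by simp)).mul (ih fun i hi => hP i (by simp [hi]))

theorem CoeffDegreeLE.antideriv {P : Polynomial (MvPolynomial σ ℝ)} {d : ℕ}
    (hP : CoeffDegreeLE P d) : CoeffDegreeLE (antideriv P) d
  | 0 => by simp [coeff_antideriv_zero]
  | k + 1 => by
    rw [coeff_antideriv_succ]
    exact (totalDegree_smul_le _ _).trans (hP k)

theorem CoeffDegreeLE.aeval {g : σ → Polynomial (MvPolynomial σ ℝ)} {d : ℕ}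
    (hg : ∀ j, CoeffDegreeLE (g j) d) (p : MvPolynomial σ ℝ) :
    CoeffDegreeLE (aeval g p) (p.totalDegree * d) := by
  have h : MvPolynomial.aeval g p =
      ∑ s ∈ p.support, p.coeff s • ∏ i ∈ s.support, g i ^ s i := by
    rw [aeval_def, eval₂_eq]
    exact Finset.sum_congr rfl fun s _ => by rw [Algebra.smul_def]
  rw [h]
  refine CoeffDegreeLE.sum fun s hs => CoeffDegreeLE.smul _ ?_
  refine (CoeffDegreeLE.prod fun i _ => (hg i).pow (s i)).mono ?_
  rw [← Finset.sum_mul]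
  exact Nat.mul_le_mul_right _ (le_totalDegree hs)

theorem CoeffDegreeLE.totalDegree_eval {P : Polynomial (MvPolynomial σ ℝ)} {d : ℕ}
    (hP : CoeffDegreeLE P d) (T : ℝ) : (P.eval (C T)).totalDegree ≤ d := by
  rw [Polynomial.eval_eq_sum_range]
  refine totalDegree_finsetSum_le fun i _ => ?_
  rw [← C_pow, mul_comm, ← smul_eq_C_mul]
  exact (totalDegree_smul_le _ _).trans (hP i)

/-- Picard iterates for `ẋ = F x`, starting from the zero function. -/
noncomputable def picard (F : σ → MvPolynomial σ ℝ) : ℕ → σ → Polynomial (MvPolynomial σ ℝ)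
  | 0 => 0
  | m + 1 => fun l => Polynomial.C (X l) + antideriv (aeval (picard F m) (F l))

theorem coeffDegreeLE_picard {F : σ → MvPolynomial σ ℝ} {q : ℕ} (hq : 1 ≤ q)
    (hF : ∀ i, (F i).totalDegree ≤ q) (m : ℕ) (l : σ) :
    CoeffDegreeLE (picard F (m + 1) l) (q ^ m) := by
  have hX : ∀ (m : ℕ) (l : σ),
      CoeffDegreeLE (Polynomial.C (X l : MvPolynomial σ ℝ)) (q ^ m) := fun m l k => by
    rw [Polynomial.coeff_C]
    split_ifs
    · simpa using Nat.one_le_pow _ _ hq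
    · simp
  induction m generalizing l with
  | zero =>
    refine (hX 0 l).add (CoeffDegreeLE.mono (d := 0) ?_ (by simp))
    exact (CoeffDegreeLE.aeval (d := 0) (fun j k => by simp [picard]) _).antideriv
  | succ m ih =>
    refine (hX _ l).add (((CoeffDegreeLE.aeval ih _).mono ?_).antideriv)
    rw [pow_succ, mul_comm]
    exact Nat.mul_le_mul_left _ (hF l)

/-- Integrals over `[0, T]` of squares are sums of squares. -/
theorem isSumSq_integral_sq (P : Polynomial (MvPolynomial σ ℝ)) {T : ℝ} (hT : 0 ≤ T) :
    IsSumSq ((antideriv (P ^ 2)).eval (C T)) := by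
  set d := P.natDegree + 1
  let H : Matrix (Fin d) (Fin d) ℝ := fun i j =>
    T ^ ((i : ℕ) + j + 1) / ((i : ℕ) + (j : ℕ) + 1)
  have hH : H.PosSemidef := by
    refine Matrix.PosSemidef.of_dotProduct_mulVec_nonneg ?_ ?_
    · ext i j
      rw [Matrix.conjTranspose_apply, star_trivial]
      simp only [H, add_comm (i : ℕ), add_comm (i : ℝ)]
    · intro x
      have key : star x ⬝ᵥ (H.mulVec x) =
          ∫ t in (0 : ℝ)..T, (∑ i : Fin d, x i * t ^ (i : ℕ)) ^ 2 := by
        have : ∀ t : ℝ, (∑ i : Fin d, x i * t ^ (i : ℕ)) ^ 2 =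
            ∑ i : Fin d, ∑ j : Fin d, x i * x j * t ^ ((i : ℕ) + j) := fun t => by
          rw [sq, Finset.sum_mul_sum]
          exact Finset.sum_congr rfl fun i _ => Finset.sum_congr rfl fun j _ => by
            rw [pow_add]; ring
        simp_rw [this]
        rw [intervalIntegral.integral_finsetSum fun i _ =>
          (by fun_prop : Continuous fun t : ℝ =>
            ∑ j : Fin d, x i * x j * t ^ ((i : ℕ) + j)).intervalIntegrable _ _]
        refine Finset.sum_congr rfl fun i _ => ?_
        rw [intervalIntegral.integral_finsetSum fun j _ =>
          (by fun_prop : Continuous fun t : ℝ =>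
            x i * x j * t ^ ((i : ℕ) + j)).intervalIntegrable _ _]
        simp only [Matrix.mulVec, dotProduct, Finset.mul_sum]
        refine Finset.sum_congr rfl fun j _ => ?_
        rw [intervalIntegral.integral_const_mul, integral_pow]
        simp [H]
        ring
      rw [key]
      exact intervalIntegral.integral_nonneg hT fun t _ => sq_nonneg _
  obtain ⟨B, hB⟩ : ∃ B : Matrix (Fin d) (Fin d) ℝ, H = star B * B := by
    open scoped MatrixOrder in
    exact CStarAlgebra.nonneg_iff_eq_star_mul_self.mp hH.nonneg
  have hP : P = ∑ i : Fin d, Polynomial.monomial (i : ℕ) (P.coeff i) := by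
    conv_lhs => rw [P.as_sum_range]
    rw [Finset.sum_range]
  have hlin : ∀ (s : Finset (Fin d × Fin d)) (Q : Fin d × Fin d → Polynomial (MvPolynomial σ ℝ)),
      antideriv (∑ a ∈ s, Q a) = ∑ a ∈ s, antideriv (Q a) := fun s Q =>
    map_sum (AddMonoidHom.mk' (antideriv (σ := σ)) antideriv_add) Q s
  have hV : (antideriv (P ^ 2)).eval (C T) =
      ∑ k : Fin d, (∑ i : Fin d, B k i • P.coeff i) * (∑ i : Fin d, B k i • P.coeff i) := by
    have h1 : P ^ 2 = ∑ a : Fin d × Fin d,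
        Polynomial.monomial ((a.1 : ℕ) + a.2) (P.coeff a.1 * P.coeff a.2) := by
      conv_lhs => rw [hP, sq, Finset.sum_mul_sum]
      rw [Fintype.sum_prod_type]
      simp [Polynomial.monomial_mul_monomial]
    rw [h1, hlin, Polynomial.eval_finsetSum]
    simp_rw [Finset.sum_mul_sum]
    rw [Finset.sum_comm, Fintype.sum_prod_type]
    refine Finset.sum_congr rfl fun i _ => ?_
    rw [Finset.sum_comm]
    refine Finset.sum_congr rfl fun j _ => ?_
    have hij : H i j = ∑ k, B k i * B k j := by
      rw [hB, Matrix.mul_apply]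
      simp [Matrix.star_apply]
    rw [antideriv_monomial, Polynomial.eval_monomial]
    simp_rw [smul_mul_smul_comm]
    rw [← Finset.sum_smul, ← hij, ← C_pow, mul_comm, ← smul_eq_C_mul, smul_smul]
    congr 1
    simp [H, div_eq_mul_inv]
  rw [hV]
  exact IsSumSq.sum fun k _ => IsSumSq.mul_self _

theorem exists_sum_sq_of_isSumSq {R : Type*} [CommSemiring R] {V : R} (hV : IsSumSq V) :
    ∃ (m : ℕ) (h : Fin m → R), V = ∑ j, h j ^ 2 := by
  induction hV with
  | zero => exact ⟨0, 0, by simp⟩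
  | sq_add a _ ih =>
    obtain ⟨m, h, rfl⟩ := ih
    exact ⟨m + 1, Fin.cons a h, by simp [Fin.sum_univ_succ, sq]⟩

/-- Evaluation of a polynomial path at the point `x` and the time `t`. -/
noncomputable def pathEval (x : σ → ℝ) (t : ℝ) : Polynomial (MvPolynomial σ ℝ) →ₐ[ℝ] ℝ :=
  (Polynomial.aeval t).comp (Polynomial.mapAlgHom (aeval x))

theorem pathEval_apply (x : σ → ℝ) (t : ℝ) (P : Polynomial (MvPolynomial σ ℝ)) :
    pathEval x t P = (P.map (eval x)).eval t := by
  rw [← Polynomial.coe_aeval_eq_eval]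
  rfl

theorem pathEval_zero (x : σ → ℝ) (P : Polynomial (MvPolynomial σ ℝ)) :
    pathEval x 0 P = eval x (P.coeff 0) := by
  rw [pathEval_apply, ← Polynomial.coeff_zero_eq_eval_zero, Polynomial.coeff_map]

theorem eval_eval_C (x : σ → ℝ) (T : ℝ) (P : Polynomial (MvPolynomial σ ℝ)) :
    eval x (P.eval (C T)) = pathEval x T P := by
  rw [pathEval_apply, Polynomial.eval_map, Polynomial.eval, Polynomial.hom_eval₂]
  simp

theorem hasDerivAt_pathEval (x : σ → ℝ) (P : Polynomial (MvPolynomial σ ℝ)) (t : ℝ) :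
    HasDerivAt (fun s => pathEval x s P) (pathEval x t (Polynomial.derivative P)) t := by
  simp_rw [pathEval_apply, ← Polynomial.derivative_map]
  exact Polynomial.hasDerivAt _ t

theorem pathEval_aeval (x : σ → ℝ) (t : ℝ) (g : σ → Polynomial (MvPolynomial σ ℝ))
    (p : MvPolynomial σ ℝ) :
    pathEval x t (aeval g p) = eval (fun j => pathEval x t (g j)) p := by
  rw [comp_aeval_apply, ← MvPolynomial.aeval_eq_eval]

/-- The derivation along a constant vector field. -/
noncomputable def along (v : σ → ℝ) : Derivation ℝ (MvPolynomial σ ℝ) (MvPolynomial σ ℝ) :=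
  mkDerivation ℝ fun j => C (v j)

variable {F : σ → MvPolynomial σ ℝ}

/-- The vector field with components `P`. -/
noncomputable def field (P : σ → MvPolynomial σ ℝ) (x : EuclideanSpace ℝ σ) :
    EuclideanSpace ℝ σ :=
  WithLp.toLp 2 fun l => eval (fun j => x j) (P l)

/-- The curve with polynomial path components `P`. -/
noncomputable def curve (P : σ → Polynomial (MvPolynomial σ ℝ)) (x : EuclideanSpace ℝ σ) (t : ℝ) :
    EuclideanSpace ℝ σ :=
  WithLp.toLp 2 fun l => pathEval (fun j => x j) t (P l)

theorem field_curve (A : σ → MvPolynomial σ ℝ) (P : σ → Polynomial (MvPolynomial σ ℝ))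
    (x : EuclideanSpace ℝ σ) (t : ℝ) :
    field A (curve P x t) = curve (fun l => aeval P (A l)) x t := by
  ext l
  simp [field, curve, pathEval_aeval]

/-- The Picard iterate number `m` as a curve. -/
noncomputable def pic (F : σ → MvPolynomial σ ℝ) (m : ℕ) (x : EuclideanSpace ℝ σ) (t : ℝ) :
    EuclideanSpace ℝ σ := curve (picard F m) x t

/-- The directional derivative of a Picard iterate with respect to the initial value. -/
noncomputable def varPic (F : σ → MvPolynomial σ ℝ) (m : ℕ) (x v : EuclideanSpace ℝ σ) (t : ℝ) :
    EuclideanSpace ℝ σ := curve (fun l => coeffwise (along fun j => v j) (picard F m l)) x t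

theorem pic_zero (x : EuclideanSpace ℝ σ) (t : ℝ) : pic F 0 x t = 0 := by
  ext l
  simp [pic, curve, picard]

theorem pic_succ_zero (m : ℕ) (x : EuclideanSpace ℝ σ) : pic F (m + 1) x 0 = x := by
  ext l
  simp [pic, curve, picard, pathEval_zero, coeff_antideriv_zero]

theorem derivative_picard_succ (F : σ → MvPolynomial σ ℝ) (m : ℕ) :
    (fun l => Polynomial.derivative (picard F (m + 1) l)) = fun l => aeval (picard F m) (F l) := by
  funext l
  simp [picard, derivative_antideriv]

theorem varPic_zero (x v : EuclideanSpace ℝ σ) (t : ℝ) : varPic F 0 x v t = 0 := by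
  ext l
  simp [varPic, curve, picard]

theorem varPic_succ_zero (m : ℕ) (x v : EuclideanSpace ℝ σ) : varPic F (m + 1) x v 0 = v := by
  ext l
  simp [varPic, curve, picard, pathEval_zero, coeff_antideriv_zero, coeff_coeffwise, along,
    mkDerivation_X]

section Fintype

variable [Fintype σ]

theorem eval_along (v x : σ → ℝ) (p : MvPolynomial σ ℝ) :
    eval x (along v p) = ∑ j, eval x (pderiv j p) * v j := by
  have h := derivation_aeval (along v) X p
  simp only [aeval_X_left, AlgHom.id_apply] at h
  rw [h]
  simp [along, mkDerivation_X]

/-- The Jacobian of `field P` at `x`, applied to `v`. -/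
noncomputable def jac (P : σ → MvPolynomial σ ℝ) (x v : EuclideanSpace ℝ σ) :
    EuclideanSpace ℝ σ :=
  WithLp.toLp 2 fun l => ∑ j, eval (fun j => x j) (pderiv j (P l)) * v j

theorem jac_sub (P : σ → MvPolynomial σ ℝ) (x v w : EuclideanSpace ℝ σ) :
    jac P x v - jac P x w = jac P x (v - w) := by
  ext l
  simp [jac, ← Finset.sum_sub_distrib, mul_sub]

theorem hasDerivAt_toLp {u : ℝ → σ → ℝ} {u' : σ → ℝ} {t : ℝ}
    (h : ∀ l, HasDerivAt (fun s => u s l) (u' l) t) :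
    HasDerivAt (fun s => (WithLp.toLp 2 (u s) : EuclideanSpace ℝ σ)) (WithLp.toLp 2 u') t :=
  ((EuclideanSpace.equiv σ ℝ).symm : (σ → ℝ) →L[ℝ] EuclideanSpace ℝ σ).hasFDerivAt.comp_hasDerivAt
    t (hasDerivAt_pi.2 h)

theorem hasDerivAt_curve (P : σ → Polynomial (MvPolynomial σ ℝ)) (x : EuclideanSpace ℝ σ) (t : ℝ) :
    HasDerivAt (curve P x) (curve (fun l => Polynomial.derivative (P l)) x t) t :=
  hasDerivAt_toLp fun _ => hasDerivAt_pathEval _ _ _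

theorem jac_curve (A : σ → MvPolynomial σ ℝ) (P : σ → Polynomial (MvPolynomial σ ℝ))
    (d : Derivation ℝ (Polynomial (MvPolynomial σ ℝ)) (Polynomial (MvPolynomial σ ℝ)))
    (x : EuclideanSpace ℝ σ) (t : ℝ) :
    curve (fun l => d (aeval P (A l))) x t =
      jac A (curve P x t) (curve (fun l => d (P l)) x t) := by
  ext l
  simp [jac, curve, derivation_aeval, pathEval_aeval]

theorem hasDerivAt_field_curve (A : σ → MvPolynomial σ ℝ)
    (P : σ → Polynomial (MvPolynomial σ ℝ)) (x : EuclideanSpace ℝ σ) (t : ℝ) :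
    HasDerivAt (fun s => field A (curve P x s))
      (jac A (curve P x t) (curve (fun l => Polynomial.derivative (P l)) x t)) t := by
  have h := jac_curve A P ((Polynomial.derivative' (R := MvPolynomial σ ℝ)).restrictScalars ℝ) x t
  simp_rw [field_curve]
  convert hasDerivAt_curve (fun l => aeval P (A l)) x t using 1
  exact h.symm

theorem hasDerivAt_field_line (A : σ → MvPolynomial σ ℝ) (y w : EuclideanSpace ℝ σ) :
    HasDerivAt (fun s : ℝ => field A (y + s • w)) (jac A y w) 0 := by
  have h := hasDerivAt_field_curve A
    (fun j => Polynomial.C (C (y j)) + Polynomial.X * Polynomial.C (C (w j))) y 0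
  convert h using 1
  · ext s l
    simp only [field, curve, pathEval_apply]
    congr 2
    ext j
    simp
    ring
  · congr 1 <;> ext l <;> simp [curve, pathEval_apply]

theorem norm_le_of_hasDerivAt {E : Type*} [NormedAddCommGroup E] [NormedSpace ℝ E]
    {u u' : ℝ → E} {B B' : ℝ → ℝ} {T : ℝ}
    (hu : ∀ t ∈ Set.Icc 0 T, HasDerivAt u (u' t) t) (h0 : ‖u 0‖ ≤ B 0)
    (hB : ∀ t, HasDerivAt B (B' t) t) (bound : ∀ t ∈ Set.Icc 0 T, ‖u' t‖ ≤ B' t) :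
    ∀ t ∈ Set.Icc 0 T, ‖u t‖ ≤ B t :=
  image_norm_le_of_norm_deriv_right_le_deriv_boundary
    (fun t ht => (hu t ht).continuousAt.continuousWithinAt)
    (fun t ht => (hu t (Set.Ico_subset_Icc_self ht)).hasDerivWithinAt) h0 hB
    fun t ht => bound t (Set.Ico_subset_Icc_self ht)

theorem le_of_hasDerivAt_le {u u' B B' : ℝ → ℝ} {T : ℝ} (hT : 0 ≤ T)
    (hu : ∀ t, HasDerivAt u (u' t) t) (h0 : u 0 ≤ B 0)
    (hB : ∀ t, HasDerivAt B (B' t) t) (bound : ∀ t ∈ Set.Icc 0 T, u' t ≤ B' t) : u T ≤ B T :=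
  image_le_of_deriv_right_le_deriv_boundary
    (fun t _ => (hu t).continuousAt.continuousWithinAt)
    (fun t _ => (hu t).hasDerivWithinAt) h0
    (fun t _ => (hB t).continuousAt.continuousWithinAt)
    (fun t _ => (hB t).hasDerivWithinAt)
    (fun t ht => bound t (Set.Ico_subset_Icc_self ht)) ⟨hT, le_rfl⟩

theorem hasDerivAt_pow_div_factorial (L a : ℝ) (m : ℕ) (t : ℝ) :
    HasDerivAt (fun s => a * ((L * s) ^ (m + 1) / (m + 1).factorial))
      (L * (a * ((L * t) ^ m / m.factorial))) t := by
  have h := ((((hasDerivAt_id t).const_mul L).pow (m + 1)).div_const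
    ((m + 1).factorial : ℝ)).const_mul a
  have h1 : (m.factorial : ℝ) ≠ 0 := by positivity
  have h2 : ((m : ℝ) + 1) ≠ 0 := by positivity
  refine h.congr_deriv ?_
  push_cast [Nat.factorial_succ]
  field_simp
  simp

theorem hasDerivAt_exp_mul (L a t : ℝ) :
    HasDerivAt (fun s => Real.exp (L * s) * a) (L * (Real.exp (L * t) * a)) t := by
  have h := (((hasDerivAt_id t).const_mul L).exp).mul_const a
  exact h.congr_deriv (by simp; ring)

section Estimates

variable {L R T : ℝ}

theorem hasDerivAt_pic_succ (m : ℕ) (x : EuclideanSpace ℝ σ) (t : ℝ) :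
    HasDerivAt (pic F (m + 1) x) (field F (pic F m x t)) t := by
  have h := hasDerivAt_curve (picard F (m + 1)) x t
  rw [derivative_picard_succ, ← field_curve] at h
  exact h

theorem hasDerivAt_varPic_succ (m : ℕ) (x v : EuclideanSpace ℝ σ) (t : ℝ) :
    HasDerivAt (varPic F (m + 1) x v) (jac F (pic F m x t) (varPic F m x v t)) t := by
  have h := hasDerivAt_curve
    (fun l => coeffwise (along fun j => v j) (picard F (m + 1) l)) x t
  simp_rw [derivative_coeffwise, congrFun (derivative_picard_succ F m)] at h
  rw [jac_curve] at h
  exact h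

theorem hasDerivAt_field_pic_succ (A : σ → MvPolynomial σ ℝ) (m : ℕ) (x : EuclideanSpace ℝ σ)
    (t : ℝ) :
    HasDerivAt (fun s => field A (pic F (m + 1) x s))
      (jac A (pic F (m + 1) x t) (field F (pic F m x t))) t := by
  have h := hasDerivAt_field_curve A (picard F (m + 1)) x t
  rw [derivative_picard_succ, ← field_curve] at h
  exact h

/-- `field F` vanishes at the origin and is `L`-Lipschitz on the closed ball of radius `R`. -/
structure LipschitzField (F : σ → MvPolynomial σ ℝ) (L R : ℝ) : Prop where
  nonneg : 0 ≤ L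
  zero : field F 0 = 0
  lip : ∀ y ∈ Metric.closedBall (0 : EuclideanSpace ℝ σ) R,
    ∀ z ∈ Metric.closedBall (0 : EuclideanSpace ℝ σ) R, ‖field F y - field F z‖ ≤ L * ‖y - z‖

theorem LipschitzField.norm_jac_le (h : LipschitzField F L R)
    {y : EuclideanSpace ℝ σ} (hy : ‖y‖ < R) (w : EuclideanSpace ℝ σ) :
    ‖jac F y w‖ ≤ L * ‖w‖ := by
  have hL := h.nonneg
  refine (hasDerivAt_field_line F y w).le_of_lip' (by positivity) ?_
  have hc : Continuous fun s : ℝ => ‖y + s • w‖ := by fun_prop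
  have hev : ∀ᶠ s : ℝ in nhds 0, ‖y + s • w‖ < R :=
    hc.continuousAt.eventually_lt continuousAt_const (by simpa using hy)
  filter_upwards [hev] with s hs
  refine (h.lip _ (by simpa using hs.le) _ (by simpa using hy.le)).trans (le_of_eq ?_)
  simp [norm_smul]
  ring

theorem LipschitzField.norm_le (h : LipschitzField F L R) {y : EuclideanSpace ℝ σ}
    (hy : ‖y‖ ≤ R) : ‖field F y‖ ≤ L * ‖y‖ := by
  have h1 := h.lip y (by simpa using hy) 0 (by simpa using (norm_nonneg y).trans hy)
  simpa [h.zero] using h1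

theorem LipschitzField.exp_mul_le (h : LipschitzField F L R) {a t : ℝ} (ha : 0 ≤ a)
    (ht : t ∈ Set.Icc 0 T) : Real.exp (L * t) * a ≤ Real.exp (L * T) * a :=
  mul_le_mul_of_nonneg_right
    (Real.exp_le_exp.2 (mul_le_mul_of_nonneg_left ht.2 h.nonneg)) ha

theorem LipschitzField.norm_pic_le (h : LipschitzField F L R) {x : EuclideanSpace ℝ σ}
    (hx : Real.exp (L * T) * ‖x‖ ≤ R) (m : ℕ) :
    ∀ t ∈ Set.Icc 0 T, ‖pic F m x t‖ ≤ Real.exp (L * t) * ‖x‖ := by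
  induction m with
  | zero => intro t _; rw [pic_zero, norm_zero]; positivity
  | succ m ih =>
    refine norm_le_of_hasDerivAt (fun t _ => hasDerivAt_pic_succ m x t) ?_
      (fun t => hasDerivAt_exp_mul L ‖x‖ t) fun t ht => ?_
    · simp [pic_succ_zero]
    · exact (h.norm_le ((ih t ht).trans ((h.exp_mul_le (norm_nonneg _) ht).trans hx))).trans
        (mul_le_mul_of_nonneg_left (ih t ht) h.nonneg)

theorem LipschitzField.norm_pic_sub_pic_le (h : LipschitzField F L R)
    {x y : EuclideanSpace ℝ σ} (hx : Real.exp (L * T) * ‖x‖ ≤ R)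
    (hy : Real.exp (L * T) * ‖y‖ ≤ R) (m : ℕ) :
    ∀ t ∈ Set.Icc 0 T, ‖pic F m x t - pic F m y t‖ ≤ Real.exp (L * t) * ‖x - y‖ := by
  induction m with
  | zero => intro t _; rw [pic_zero, pic_zero, sub_zero, norm_zero]; positivity
  | succ m ih =>
    refine norm_le_of_hasDerivAt
      (fun t _ => (hasDerivAt_pic_succ m x t).sub (hasDerivAt_pic_succ m y t)) ?_
      (fun t => hasDerivAt_exp_mul L ‖x - y‖ t) fun t ht => ?_
    · simp [pic_succ_zero]
    · refine (h.lip _ ?_ _ ?_).trans (mul_le_mul_of_nonneg_left (ih t ht) h.nonneg)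
      · simpa using (h.norm_pic_le hx m t ht).trans ((h.exp_mul_le (norm_nonneg _) ht).trans hx)
      · simpa using (h.norm_pic_le hy m t ht).trans ((h.exp_mul_le (norm_nonneg _) ht).trans hy)

theorem LipschitzField.norm_varPic_le (h : LipschitzField F L R)
    {x : EuclideanSpace ℝ σ} (hx : Real.exp (L * T) * ‖x‖ < R) (v : EuclideanSpace ℝ σ) (m : ℕ) :
    ∀ t ∈ Set.Icc 0 T, ‖varPic F m x v t‖ ≤ Real.exp (L * t) * ‖v‖ := by
  induction m with
  | zero => intro t _; rw [varPic_zero, norm_zero]; positivity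
  | succ m ih =>
    refine norm_le_of_hasDerivAt (fun t _ => hasDerivAt_varPic_succ m x v t) ?_
      (fun t => hasDerivAt_exp_mul L ‖v‖ t) fun t ht => ?_
    · simp [varPic_succ_zero]
    · refine (h.norm_jac_le ?_ _).trans (mul_le_mul_of_nonneg_left (ih t ht) h.nonneg)
      exact (h.norm_pic_le hx.le m t ht).trans_lt
        ((h.exp_mul_le (norm_nonneg _) ht).trans_lt hx)

/-- Distance between a Picard iterate and an exact solution. -/
theorem LipschitzField.norm_pic_sub_le (h : LipschitzField F L R) {x : EuclideanSpace ℝ σ}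
    (hx : Real.exp (L * T) * ‖x‖ ≤ R) {u : ℝ → EuclideanSpace ℝ σ} {b : ℝ} (hb : b ≤ R)
    (hu0 : u 0 = x) (hu : ∀ t ∈ Set.Icc 0 T, HasDerivAt u (field F (u t)) t)
    (hub : ∀ t ∈ Set.Icc 0 T, ‖u t‖ ≤ b) (m : ℕ) :
    ∀ t ∈ Set.Icc 0 T, ‖pic F m x t - u t‖ ≤ b * ((L * t) ^ m / m.factorial) := by
  induction m with
  | zero => intro t ht; simpa [pic_zero] using hub t ht
  | succ m ih =>
    refine norm_le_of_hasDerivAt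
      (fun t ht => (hasDerivAt_pic_succ m x t).sub (hu t ht)) ?_
      (fun t => hasDerivAt_pow_div_factorial L b m t) fun t ht => ?_
    · simp [pic_succ_zero, hu0]
    · refine (h.lip _ ?_ _ ?_).trans (mul_le_mul_of_nonneg_left (ih t ht) h.nonneg)
      · simpa using (h.norm_pic_le hx m t ht).trans ((h.exp_mul_le (norm_nonneg _) ht).trans hx)
      · simpa using (hub t ht).trans hb

/-- Defect of a Picard iterate in the invariance of exact flows along the vector field. -/
theorem LipschitzField.norm_varPic_sub_le (h : LipschitzField F L R) {x : EuclideanSpace ℝ σ}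
    (hT : 0 ≤ T) (hx : Real.exp (L * T) * ‖x‖ < R) (m : ℕ) :
    ∀ t ∈ Set.Icc 0 T, ‖varPic F (m + 1) x (field F x) t - field F (pic F m x t)‖ ≤
      L * ‖x‖ * ((L * t) ^ m / m.factorial) := by
  have hxR : ‖x‖ ≤ R := by
    refine le_trans ?_ hx.le
    exact le_mul_of_one_le_left (norm_nonneg _) (Real.one_le_exp (mul_nonneg h.nonneg hT))
  induction m with
  | zero =>
    intro t ht
    simp only [pic_zero, h.zero, sub_zero, pow_zero, Nat.factorial_zero, Nat.cast_one, div_one,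
      mul_one]
    refine norm_le_of_hasDerivAt (fun t _ => hasDerivAt_varPic_succ 0 x (field F x) t) ?_
      (fun t => hasDerivAt_const t (L * ‖x‖)) (fun t _ => ?_) t ht
    · rw [varPic_succ_zero]
      exact h.norm_le hxR
    · simp [jac, varPic_zero, ← Pi.zero_def]
  | succ m ih =>
    refine norm_le_of_hasDerivAt (fun t _ => (hasDerivAt_varPic_succ (m + 1) x (field F x) t).sub
      (hasDerivAt_field_pic_succ F m x t)) ?_
      (fun t => hasDerivAt_pow_div_factorial L (L * ‖x‖) m t) fun t ht => ?_
    · simp [varPic_succ_zero, pic_succ_zero]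
    · rw [jac_sub]
      refine (h.norm_jac_le ?_ _).trans (mul_le_mul_of_nonneg_left (ih t ht) h.nonneg)
      exact (h.norm_pic_le hx.le _ t ht).trans_lt
        ((h.exp_mul_le (norm_nonneg _) ht).trans_lt hx)

end Estimates

end Fintype

/-- Composition of `i` polynomial approximations of the time-`T` flow; the `j`-th one is the
Picard iterate number `μ j + 1`. -/
noncomputable def flow (F : σ → MvPolynomial σ ℝ) (μ : ℕ → ℕ) (T : ℝ) :
    ℕ → σ → MvPolynomial σ ℝ
  | 0 => X
  | i + 1 => fun l => (aeval (picard F (μ i + 1)) (flow F μ T i l)).eval (C T)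

/-- The polynomial path `t ↦ flow i (pic (μ i + 1) x t)`. -/
noncomputable def flowPath (F : σ → MvPolynomial σ ℝ) (μ : ℕ → ℕ) (T : ℝ) (i : ℕ) (l : σ) :
    Polynomial (MvPolynomial σ ℝ) :=
  aeval (picard F (μ i + 1)) (flow F μ T i l)

theorem field_flow_succ (μ : ℕ → ℕ) (T : ℝ) (i : ℕ) (x : EuclideanSpace ℝ σ) :
    field (flow F μ T (i + 1)) x = field (flow F μ T i) (pic F (μ i + 1) x T) := by
  rw [pic, field_curve]
  ext l
  simp [field, curve, flow, eval_eval_C]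

theorem field_flow_zero (μ : ℕ → ℕ) (T : ℝ) (x : EuclideanSpace ℝ σ) :
    field (flow F μ T 0) x = x := by
  ext l
  simp [field, flow]

theorem curve_flowPath (μ : ℕ → ℕ) (T : ℝ) (i : ℕ) (x : EuclideanSpace ℝ σ) (t : ℝ) :
    curve (flowPath F μ T i) x t = field (flow F μ T i) (pic F (μ i + 1) x t) := by
  rw [pic, field_curve]
  rfl

theorem totalDegree_flow_le {q : ℕ} (hq : 1 ≤ q) (hF : ∀ i, (F i).totalDegree ≤ q) (μ : ℕ → ℕ)
    (T : ℝ) (i : ℕ) (l : σ) :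
    (flow F μ T i l).totalDegree ≤ q ^ ∑ j ∈ Finset.range i, μ j := by
  induction i with
  | zero => simp [flow]
  | succ i ih =>
    refine ((CoeffDegreeLE.aeval (coeffDegreeLE_picard hq hF (μ i)) _).totalDegree_eval T).trans ?_
    rw [Finset.sum_range_succ, pow_add]
    exact Nat.mul_le_mul_right _ ih

theorem coeffDegreeLE_flowPath {q : ℕ} (hq : 1 ≤ q) (hF : ∀ i, (F i).totalDegree ≤ q)
    (μ : ℕ → ℕ) (T : ℝ) (i : ℕ) (l : σ) :
    CoeffDegreeLE (flowPath F μ T i l) (q ^ ∑ j ∈ Finset.range (i + 1), μ j) := by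
  refine (CoeffDegreeLE.aeval (coeffDegreeLE_picard hq hF (μ i)) _).mono ?_
  rw [Finset.sum_range_succ, pow_add]
  exact Nat.mul_le_mul_right _ (totalDegree_flow_le hq hF μ T i l)

/-- The accumulated relative error of `flow`. -/
noncomputable def defect (L T : ℝ) (μ : ℕ → ℕ) (i : ℕ) : ℝ :=
  ∑ j ∈ Finset.range i,
    Real.exp (L * T) ^ j * ((L * T) ^ (μ j + 1) / (μ j + 1).factorial)

theorem defect_mono {L T : ℝ} (h : 0 ≤ L * T) (μ : ℕ → ℕ) : Monotone (defect L T μ) :=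
  monotone_nat_of_le_succ fun i => by
    rw [defect, defect, Finset.sum_range_succ]
    exact le_add_of_nonneg_right (by positivity)

section Fintype

variable [Fintype σ]

theorem jac_flow_succ (μ : ℕ → ℕ) (T : ℝ) (i : ℕ) (x v : EuclideanSpace ℝ σ) :
    jac (flow F μ T (i + 1)) x v =
      jac (flow F μ T i) (pic F (μ i + 1) x T) (varPic F (μ i + 1) x v T) := by
  rw [pic, varPic, ← jac_curve]
  ext l
  simp only [jac, curve, flow]
  rw [← eval_along, ← eval_coeffwise, eval_eval_C]

theorem jac_flow_zero (μ : ℕ → ℕ) (T : ℝ) (x v : EuclideanSpace ℝ σ) :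
    jac (flow F μ T 0) x v = v := by
  classical
  ext l
  simp [jac, flow, pderiv_X, Pi.single_apply, apply_ite]

section Estimates

variable {L R T b : ℝ} {u : ℝ → EuclideanSpace ℝ σ}

/-- `flow` stays close to an exact trajectory, and its Jacobian is bounded there. -/
theorem LipschitzField.norm_flow_sub_le (h : LipschitzField F L R) (hT : 0 ≤ T)
    (hb : Real.exp (L * T) * (2 * b) < R) (hu : ∀ t ≥ 0, HasDerivAt u (field F (u t)) t)
    (hub : ∀ t ≥ 0, ‖u t‖ ≤ b) (μ : ℕ → ℕ) (i : ℕ) :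
    ∀ s ≥ 0, ∀ (p : EuclideanSpace ℝ σ) (a : ℝ), ‖p - u s‖ ≤ a →
      Real.exp (L * T) ^ i * a + b * defect L T μ i ≤ b →
      ‖field (flow F μ T i) p - u (s + i * T)‖ ≤
        Real.exp (L * T) ^ i * a + b * defect L T μ i ∧
      ∀ v, ‖jac (flow F μ T i) p v‖ ≤ Real.exp (L * T) ^ i * ‖v‖ := by
  have hL := h.nonneg
  have hb0 : 0 ≤ b := (norm_nonneg _).trans (hub 0 le_rfl)
  have hE : 1 ≤ Real.exp (L * T) := Real.one_le_exp (mul_nonneg hL hT)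
  have hD : ∀ i, 0 ≤ defect L T μ i := fun i => by unfold defect; positivity
  induction i with
  | zero =>
    intro s hs p a hp _
    refine ⟨by simpa [field_flow_zero, defect] using hp, fun v => by simp [jac_flow_zero]⟩
  | succ i ih =>
    intro s hs p a hp ha
    have ha0 : 0 ≤ a := (norm_nonneg _).trans hp
    have hab : a ≤ b := by
      have h1 := le_mul_of_one_le_left ha0 (one_le_pow₀ hE (n := i + 1))
      have h2 := mul_nonneg hb0 (hD (i + 1))
      linarith
    have hp2 : ‖p‖ ≤ 2 * b := by
      have h1 := norm_le_norm_add_norm_sub' p (u s)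
      linarith [hub s hs]
    have hpR : Real.exp (L * T) * ‖p‖ < R :=
      (mul_le_mul_of_nonneg_left hp2 (by positivity)).trans_lt hb
    have hbR : 2 * b ≤ R := (le_mul_of_one_le_left (by positivity) hE).trans hb.le
    have hTm : T ∈ Set.Icc 0 T := ⟨hT, le_rfl⟩
    have hus : ‖u s‖ ≤ 2 * b := (hub s hs).trans (by linarith)
    have hsR : Real.exp (L * T) * ‖u s‖ < R :=
      (mul_le_mul_of_nonneg_left hus (by positivity)).trans_lt hb
    have step : ‖pic F (μ i + 1) p T - u (s + T)‖ ≤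
        Real.exp (L * T) * a + b * ((L * T) ^ (μ i + 1) / (μ i + 1).factorial) := by
      have h1 := h.norm_pic_sub_pic_le hpR.le hsR.le (μ i + 1) T hTm
      have h2 := h.norm_pic_sub_le hsR.le (u := fun t => u (s + t)) (b := b) (by linarith)
        (by simp) (fun t ht => (hu (s + t) (add_nonneg hs ht.1)).comp_const_add s t)
        (fun t ht => hub (s + t) (add_nonneg hs ht.1)) (μ i + 1) T hTm
      have h3 := norm_sub_le_norm_sub_add_norm_sub (pic F (μ i + 1) p T)
        (pic F (μ i + 1) (u s) T) (u (s + T))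
      have h4 := mul_le_mul_of_nonneg_left hp (Real.exp_pos (L * T)).le
      linarith
    have key : Real.exp (L * T) ^ i *
        (Real.exp (L * T) * a + b * ((L * T) ^ (μ i + 1) / (μ i + 1).factorial)) +
          b * defect L T μ i = Real.exp (L * T) ^ (i + 1) * a + b * defect L T μ (i + 1) := by
      rw [defect, defect, Finset.sum_range_succ]
      ring
    obtain ⟨h1, h2⟩ := ih (s + T) (add_nonneg hs hT) _ _ step (key.trans_le ha)
    constructor
    · rw [field_flow_succ, ← key]
      have e : s + ((i + 1 : ℕ) : ℝ) * T = s + T + i * T := by push_cast; ring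
      rw [e]
      exact h1
    · intro v
      rw [jac_flow_succ]
      refine (h2 _).trans ?_
      rw [pow_succ, mul_assoc]
      exact mul_le_mul_of_nonneg_left (h.norm_varPic_le hpR v _ T hTm) (by positivity)

/-- Bounds along one piece of the approximate trajectory. -/
theorem LipschitzField.norm_flowPath_le (h : LipschitzField F L R) (hT : 0 ≤ T)
    (hb : Real.exp (L * T) * (2 * b) < R) (hu : ∀ t ≥ 0, HasDerivAt u (field F (u t)) t)
    (hub : ∀ t ≥ 0, ‖u t‖ ≤ b) (μ : ℕ → ℕ) {i N : ℕ} (hi : i < N) (hN : defect L T μ N ≤ 1) :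
    ∀ t ∈ Set.Icc 0 T,
      ‖field (flow F μ T i) (pic F (μ i + 1) (u 0) t)‖ ≤ b * (1 + defect L T μ N) ∧
      ∀ v, ‖jac (flow F μ T i) (pic F (μ i + 1) (u 0) t) v‖ ≤ Real.exp (L * T) ^ i * ‖v‖ := by
  intro t ht
  have hL := h.nonneg
  have hb0 : 0 ≤ b := (norm_nonneg _).trans (hub 0 le_rfl)
  have hE : 1 ≤ Real.exp (L * T) := Real.one_le_exp (mul_nonneg hL hT)
  have hbR : 2 * b ≤ R := (le_mul_of_one_le_left (by positivity) hE).trans hb.le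
  have hxR : Real.exp (L * T) * ‖u 0‖ ≤ R :=
    (mul_le_mul_of_nonneg_left ((hub 0 le_rfl).trans (by linarith)) (by positivity)).trans hb.le
  have h1 : ‖pic F (μ i + 1) (u 0) t - u t‖ ≤
      b * ((L * T) ^ (μ i + 1) / (μ i + 1).factorial) := by
    refine (h.norm_pic_sub_le hxR (by linarith) rfl (fun s hs => hu s hs.1)
      (fun s hs => hub s hs.1) (μ i + 1) t ht).trans ?_
    have := ht.1
    have := ht.2
    gcongr
  have h2 : Real.exp (L * T) ^ i * (b * ((L * T) ^ (μ i + 1) / (μ i + 1).factorial)) +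
      b * defect L T μ i = b * defect L T μ (i + 1) := by
    rw [defect, defect, Finset.sum_range_succ]
    ring
  have h3 : b * defect L T μ (i + 1) ≤ b * defect L T μ N :=
    mul_le_mul_of_nonneg_left (defect_mono (mul_nonneg hL hT) μ hi) hb0
  have h4 : b * defect L T μ N ≤ b := mul_le_of_le_one_right hb0 hN
  obtain ⟨h5, h6⟩ := h.norm_flow_sub_le hT hb hu hub μ i t ht.1 _ _ h1 (by linarith)
  refine ⟨?_, h6⟩
  have h7 := norm_le_norm_add_norm_sub' (field (flow F μ T i) (pic F (μ i + 1) (u 0) t))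
    (u (t + i * T))
  have h8 := hub (t + i * T) (add_nonneg ht.1 (by positivity))
  linarith

end Estimates

/-- The integral of the squared norm of `flowPath` over `[0, t]`, before evaluation in `t`. -/
noncomputable def energy (F : σ → MvPolynomial σ ℝ) (μ : ℕ → ℕ) (T : ℝ) (i : ℕ) :
    Polynomial (MvPolynomial σ ℝ) :=
  ∑ l, antideriv (flowPath F μ T i l ^ 2)

theorem hasDerivAt_energy (μ : ℕ → ℕ) (T : ℝ) (i : ℕ) (x : EuclideanSpace ℝ σ) (t : ℝ) :
    HasDerivAt (fun s => pathEval (fun j => x j) s (energy F μ T i))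
      (‖field (flow F μ T i) (pic F (μ i + 1) x t)‖ ^ 2) t := by
  refine (hasDerivAt_pathEval _ _ t).congr_deriv ?_
  rw [energy, Polynomial.derivative_sum, map_sum, ← curve_flowPath, EuclideanSpace.norm_sq_eq]
  simp [derivative_antideriv, curve]

theorem coeff_energy_zero (μ : ℕ → ℕ) (T : ℝ) (i : ℕ) : (energy F μ T i).coeff 0 = 0 := by
  simp [energy, coeff_antideriv_zero]

theorem hasDerivAt_coeffwise_energy (μ : ℕ → ℕ) (T : ℝ) (i : ℕ) (x v : EuclideanSpace ℝ σ)
    (t : ℝ) :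
    HasDerivAt
      (fun s => pathEval (fun j => x j) s (coeffwise (along fun j => v j) (energy F μ T i)))
      (2 * inner ℝ (field (flow F μ T i) (pic F (μ i + 1) x t))
        (jac (flow F μ T i) (pic F (μ i + 1) x t) (varPic F (μ i + 1) x v t))) t := by
  refine (hasDerivAt_pathEval _ _ t).congr_deriv ?_
  rw [derivative_coeffwise, energy, Polynomial.derivative_sum, map_sum, map_sum,
    ← curve_flowPath, pic, varPic, ← jac_curve, PiLp.inner_apply, Finset.mul_sum]
  refine Finset.sum_congr rfl fun l _ => ?_
  simp [derivative_antideriv, curve, flowPath, sq]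
  ring

theorem isSumSq_energy (μ : ℕ → ℕ) {T : ℝ} (hT : 0 ≤ T) (i : ℕ) :
    IsSumSq ((energy F μ T i).eval (C T)) := by
  rw [energy, Polynomial.eval_finsetSum]
  exact IsSumSq.sum fun l _ => isSumSq_integral_sq _ hT

theorem totalDegree_energy_le {q : ℕ} (hq : 1 ≤ q) (hF : ∀ i, (F i).totalDegree ≤ q)
    (μ : ℕ → ℕ) (T : ℝ) (i : ℕ) :
    ((energy F μ T i).eval (C T)).totalDegree ≤ 2 * q ^ ∑ j ∈ Finset.range (i + 1), μ j :=
  (CoeffDegreeLE.sum fun l _ =>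
    ((coeffDegreeLE_flowPath hq hF μ T i l).pow 2).antideriv).totalDegree_eval T

section Lyapunov

variable {L R T b : ℝ} {u : ℝ → EuclideanSpace ℝ σ}

theorem LipschitzField.eval_energy_le (h : LipschitzField F L R) (hT : 0 ≤ T)
    (hb : Real.exp (L * T) * (2 * b) < R) (hu : ∀ t ≥ 0, HasDerivAt u (field F (u t)) t)
    (hub : ∀ t ≥ 0, ‖u t‖ ≤ b) (μ : ℕ → ℕ) {i N : ℕ} (hi : i < N) (hN : defect L T μ N ≤ 1) :
    eval (fun j => u 0 j) ((energy F μ T i).eval (C T)) ≤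
      T * (b * (1 + defect L T μ N)) ^ 2 := by
  rw [eval_eval_C]
  refine le_of_hasDerivAt_le (B := fun t => t * (b * (1 + defect L T μ N)) ^ 2) hT
    (fun t => hasDerivAt_energy μ T i (u 0) t) ?_
    (fun t => (hasDerivAt_id t).mul_const _) fun t ht => ?_
  · simp [pathEval_zero, coeff_energy_zero]
  · rw [one_mul]
    exact pow_le_pow_left₀ (norm_nonneg _) (h.norm_flowPath_le hT hb hu hub μ hi hN t ht).1 2

theorem LipschitzField.eval_along_energy_le (h : LipschitzField F L R) (hT : 0 ≤ T)
    (hb : Real.exp (L * T) * (2 * b) < R) (hu : ∀ t ≥ 0, HasDerivAt u (field F (u t)) t)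
    (hub : ∀ t ≥ 0, ‖u t‖ ≤ b) (μ : ℕ → ℕ) {i N : ℕ} (hi : i < N) (hN : defect L T μ N ≤ 1) :
    eval (fun j => u 0 j) (along (fun j => field F (u 0) j) ((energy F μ T i).eval (C T))) ≤
      ‖field (flow F μ T (i + 1)) (u 0)‖ ^ 2 - ‖field (flow F μ T i) (u 0)‖ ^ 2 +
        2 * (b * (1 + defect L T μ N)) * (Real.exp (L * T) ^ i * ‖u 0‖) *
          ((L * T) ^ (μ i + 1) / (μ i + 1).factorial) := by
  have hL := h.nonneg
  have hb0 : 0 ≤ b := (norm_nonneg _).trans (hub 0 le_rfl)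
  have hE : 1 ≤ Real.exp (L * T) := Real.one_le_exp (mul_nonneg hL hT)
  have hxR : Real.exp (L * T) * ‖u 0‖ < R :=
    (mul_le_mul_of_nonneg_left ((hub 0 le_rfl).trans (by linarith)) (by positivity)).trans_lt hb
  have hS : 0 ≤ defect L T μ N := by unfold defect; positivity
  rw [← eval_coeffwise, eval_eval_C, field_flow_succ]
  have key := le_of_hasDerivAt_le (B := fun t =>
      ‖field (flow F μ T i) (pic F (μ i + 1) (u 0) t)‖ ^ 2 -
        ‖field (flow F μ T i) (u 0)‖ ^ 2 +
      2 * (b * (1 + defect L T μ N)) * (Real.exp (L * T) ^ i * ‖u 0‖) *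
          ((L * t) ^ (μ i + 1) / (μ i + 1).factorial)) hT
    (fun t => hasDerivAt_coeffwise_energy (F := F) μ T i (u 0) (field F (u 0)) t) ?_
    (fun t => ((hasDerivAt_field_pic_succ (F := F) (flow F μ T i) (μ i) (u 0) t).norm_sq.sub_const
      _).add (hasDerivAt_pow_div_factorial L _ (μ i) t)) fun t ht => ?_
  · exact key
  · simp [pathEval_zero, coeff_coeffwise, coeff_energy_zero, pic_succ_zero]
  · obtain ⟨h1, h2⟩ := h.norm_flowPath_le hT hb hu hub μ hi hN t ht
    have h3 := h.norm_varPic_sub_le hT hxR (μ i) t ht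
    have h4 := real_inner_le_norm (field (flow F μ T i) (pic F (μ i + 1) (u 0) t))
      (jac (flow F μ T i) (pic F (μ i + 1) (u 0) t)
        (varPic F (μ i + 1) (u 0) (field F (u 0)) t - field F (pic F (μ i) (u 0) t)))
    have h5 := mul_le_mul h1 ((h2 (varPic F (μ i + 1) (u 0) (field F (u 0)) t -
      field F (pic F (μ i) (u 0) t))).trans (mul_le_mul_of_nonneg_left h3 (by positivity)))
      (norm_nonneg _) (by positivity)
    rw [← jac_sub, inner_sub_right] at h4
    rw [← jac_sub] at h5
    linarith

/-- Sum of the energies of `N` consecutive pieces. -/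
noncomputable def lyapunov (F : σ → MvPolynomial σ ℝ) (μ : ℕ → ℕ) (T : ℝ) (N : ℕ) :
    MvPolynomial σ ℝ :=
  ∑ i ∈ Finset.range N, (energy F μ T i).eval (C T)

theorem LipschitzField.eval_lyapunov_le (h : LipschitzField F L R) (hT : 0 ≤ T)
    (hb : Real.exp (L * T) * (2 * b) < R) (hu : ∀ t ≥ 0, HasDerivAt u (field F (u t)) t)
    (hub : ∀ t ≥ 0, ‖u t‖ ≤ b) (μ : ℕ → ℕ) {N : ℕ} (hN : defect L T μ N ≤ 1) :
    eval (fun j => u 0 j) (lyapunov F μ T N) ≤ N * (T * (b * (1 + defect L T μ N)) ^ 2) := by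
  rw [lyapunov, map_sum]
  refine (Finset.sum_le_card_nsmul _ _ _ fun i hi =>
    h.eval_energy_le hT hb hu hub μ (Finset.mem_range.1 hi) hN).trans (by simp)

theorem LipschitzField.eval_along_lyapunov_le (h : LipschitzField F L R) (hT : 0 ≤ T)
    (hb : Real.exp (L * T) * (2 * b) < R) (hu : ∀ t ≥ 0, HasDerivAt u (field F (u t)) t)
    (hub : ∀ t ≥ 0, ‖u t‖ ≤ b) (μ : ℕ → ℕ) {N : ℕ} (hN : defect L T μ N ≤ 1) :
    eval (fun j => u 0 j) (along (fun j => field F (u 0) j) (lyapunov F μ T N)) ≤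
      (‖u (N * T)‖ + b * defect L T μ N) ^ 2 - ‖u 0‖ ^ 2 +
        2 * (b * (1 + defect L T μ N)) * ‖u 0‖ * defect L T μ N := by
  have hb0 : 0 ≤ b := (norm_nonneg _).trans (hub 0 le_rfl)
  have h1 := Finset.sum_le_sum fun i (hi : i ∈ Finset.range N) =>
    h.eval_along_energy_le hT hb hu hub μ (Finset.mem_range.1 hi) hN
  have h2 := (h.norm_flow_sub_le hT hb hu hub μ N 0 le_rfl (u 0) 0 (by simp)
    (by simpa using mul_le_of_le_one_right hb0 hN)).1
  rw [zero_add, mul_zero, zero_add] at h2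
  have h3 := norm_le_norm_add_norm_sub' (field (flow F μ T N) (u 0)) (u (N * T))
  have h4 : ‖field (flow F μ T N) (u 0)‖ ^ 2 ≤ (‖u (N * T)‖ + b * defect L T μ N) ^ 2 :=
    pow_le_pow_left₀ (norm_nonneg _) (by linarith) 2
  have h5 : ∑ i ∈ Finset.range N,
      2 * (b * (1 + defect L T μ N)) * (Real.exp (L * T) ^ i * ‖u 0‖) *
          ((L * T) ^ (μ i + 1) / (μ i + 1).factorial) =
      2 * (b * (1 + defect L T μ N)) * ‖u 0‖ * defect L T μ N := by
    conv_rhs => rw [defect, Finset.mul_sum]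
    exact Finset.sum_congr rfl fun i _ => by rw [← defect]; ring
  rw [Finset.sum_add_distrib, Finset.sum_range_sub (fun i => ‖field (flow F μ T i) (u 0)‖ ^ 2), h5,
    field_flow_zero] at h1
  rw [lyapunov, map_sum, map_sum]
  linarith

theorem isSumSq_lyapunov (μ : ℕ → ℕ) {T : ℝ} (hT : 0 ≤ T) (N : ℕ) :
    IsSumSq (lyapunov F μ T N) := IsSumSq.sum fun i _ => isSumSq_energy μ hT i

theorem totalDegree_lyapunov_le {q : ℕ} (hq : 1 ≤ q) (hF : ∀ i, (F i).totalDegree ≤ q)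
    (μ : ℕ → ℕ) (T : ℝ) (N : ℕ) :
    (lyapunov F μ T N).totalDegree ≤ 2 * q ^ ∑ j ∈ Finset.range N, μ j := by
  refine totalDegree_finsetSum_le fun i hi => (totalDegree_energy_le hq hF μ T i).trans ?_
  gcongr 2 * q ^ ?_
  exact Finset.sum_le_sum_of_subset (Finset.range_subset_range.2 (Finset.mem_range.1 hi))

end Lyapunov

end Fintype

theorem exp_le_one_add_add {x : ℝ} (h0 : 0 ≤ x) (h1 : x ≤ 67 / 100) :
    Real.exp x ≤ 1 + x + 2844 / 10000 := by
  have h := Real.exp_bound' h0 (by linarith) (n := 5) (by norm_num)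
  norm_num [Finset.sum_range_succ, Nat.factorial] at h
  have h2 : x ^ 2 ≤ (67 / 100) ^ 2 := by gcongr
  have h3 : x ^ 3 ≤ (67 / 100) ^ 3 := by gcongr
  have h4 : x ^ 4 ≤ (67 / 100) ^ 4 := by gcongr
  have h5 : x ^ 5 ≤ (67 / 100) ^ 5 := by gcongr
  linarith

/-- If solutions contract by `1 / √2` within a short time, then `‖x‖ ^ 2` decreases along the
vector field. -/
theorem LipschitzField.inner_field_le [Fintype σ] {L R δ : ℝ} (h : LipschitzField F L R)
    {u : ℝ → EuclideanSpace ℝ σ} (hδ : 0 < δ)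
    (hLδ : L * δ ≤ 67 / 100) (hu : ∀ t ≥ 0, HasDerivAt u (field F (u t)) t)
    (hub : ∀ t ≥ 0, ‖u t‖ ≤ R) (hend : ‖u δ‖ ^ 2 ≤ ‖u 0‖ ^ 2 / 2) :
    inner ℝ (u 0) (field F (u 0)) ≤ -(1 / (200 * δ)) * ‖u 0‖ ^ 2 := by
  have hL := h.nonneg
  have h1 : ∀ t ∈ Set.Icc 0 δ, ‖u t‖ ≤ Real.exp (L * t) * ‖u 0‖ := by
    intro t ht
    have := norm_le_gronwallBound_of_norm_deriv_right_le (ε := 0) (δ := ‖u 0‖) (K := L)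
      (fun t ht => (hu t ht.1).continuousAt.continuousWithinAt)
      (fun t ht => (hu t ht.1).hasDerivWithinAt) le_rfl
      (fun t ht => by rw [add_zero]; exact h.norm_le (hub t ht.1)) t ht
    rwa [gronwallBound_ε0, sub_zero, mul_comm] at this
  have h2 : ∀ t ∈ Set.Icc 0 δ, ‖u t - u 0‖ ≤ Real.exp (L * t) * ‖u 0‖ - ‖u 0‖ :=
    norm_le_of_hasDerivAt (u := fun t => u t - u 0) (fun t ht => (hu t ht.1).sub_const _)
      (by simp) (fun t => (hasDerivAt_exp_mul L ‖u 0‖ t).sub_const _) fun t ht =>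
        (h.norm_le (hub t ht.1)).trans (mul_le_mul_of_nonneg_left (h1 t ht) hL)
  have h3 : ∀ t ∈ Set.Icc 0 δ, ‖u t - u 0 - t • field F (u 0)‖ ≤
      Real.exp (L * t) * ‖u 0‖ - ‖u 0‖ - t * (L * ‖u 0‖) := by
    refine norm_le_of_hasDerivAt (u := fun t => u t - u 0 - t • field F (u 0))
      (fun t ht => ((hu t ht.1).sub_const _).sub ((hasDerivAt_id t).smul_const _))
      (by simp) (fun t => ((hasDerivAt_exp_mul L ‖u 0‖ t).sub_const _).sub
        ((hasDerivAt_id t).mul_const _)) fun t ht => ?_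
    rw [one_smul, one_mul, ← mul_sub]
    exact (h.lip _ (by simpa using hub t ht.1) _ (by simpa using hub 0 le_rfl)).trans
      (mul_le_mul_of_nonneg_left (h2 t ht) hL)
  have h4 := h3 δ ⟨hδ.le, le_rfl⟩
  have h5 := exp_le_one_add_add (mul_nonneg hL hδ.le) hLδ
  have hx := norm_nonneg (u 0)
  have h6 := mul_le_mul_of_nonneg_right h5 hx
  have h7 : ‖u δ‖ ≤ 70715 / 100000 * ‖u 0‖ := by
    refine abs_le_of_sq_le_sq' ?_ (by positivity) |>.2
    nlinarith
  have h8 : ‖u 0 + δ • field F (u 0)‖ ≤ 992 / 1000 * ‖u 0‖ := by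
    have e : u 0 + δ • field F (u 0) = u δ - (u δ - u 0 - δ • field F (u 0)) := by abel
    rw [e]
    refine (norm_sub_le _ _).trans ?_
    nlinarith
  have h9 := pow_le_pow_left₀ (norm_nonneg _) h8 2
  rw [norm_add_sq_real, real_inner_smul_right] at h9
  have h10 : δ * inner ℝ (u 0) (field F (u 0)) ≤ -(1 / 200) * ‖u 0‖ ^ 2 := by
    nlinarith [sq_nonneg ‖δ • field F (u 0)‖]
  have e : -(1 / (200 * δ)) * ‖u 0‖ ^ 2 = (-(1 / 200) * ‖u 0‖ ^ 2) / δ := by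
    field_simp
  rw [e, le_div_iff₀ hδ]
  linarith

/-- Picard orders of total degree budget `N * k - 1` with a small defect. -/
theorem exists_defect_le {K L T δ : ℝ} {N k : ℕ} (hK : 1 ≤ K) (hL : 0 < L) (hT : 0 < T)
    (hLT : L * T < 1 / 2) (hδ : δ < N * T) (hLδ : 67 / 100 < L * δ)
    (hc : cval K T L N k ^ 2 + δ * K * ((T * L) ^ k / T) *
          (1 + cval K T L N k) * (K + cval K T L N k) < 1 / 2) :
    ∃ μ : ℕ → ℕ, ∑ j ∈ Finset.range N, μ j = N * k - 1 ∧
      K ^ 2 * defect L T μ N ≤ 131 / 1000 := by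
  have hδ0 : 0 < δ := by
    by_contra! hn
    nlinarith
  set c := cval K T L N k with hcdef
  have hP : K ^ 2 * (L * T) ^ k * ∑ j ∈ Finset.range N, Real.exp (L * T) ^ j ≤ c := by
    rw [hcdef, cval, Finset.mul_sum, mul_comm T L]
    refine Finset.sum_le_sum fun i _ => ?_
    rw [mul_comm]
    gcongr
    exact le_add_of_nonneg_right (by positivity)
  have hc0 : 0 ≤ c := le_trans (by positivity) hP
  obtain ⟨M, rfl⟩ : ∃ M, N = M + 1 := by
    refine Nat.exists_eq_succ_of_ne_zero ?_
    rintro rfl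
    simp at hδ
    linarith
  have hcsq : c ^ 2 < 1 / 2 := lt_of_le_of_lt (le_add_of_nonneg_right (by positivity)) hc
  have hKK : 1 ≤ (1 + c) * (K + c) := one_le_mul_of_one_le_of_one_le (by linarith) (by linarith)
  have hKc : 1 ≤ K * ((1 + c) * (K + c)) := one_le_mul_of_one_le_of_one_le hK hKK
  rcases k with _ | k
  · exfalso
    have h1 : δ / T ≤ δ / T * (K * ((1 + c) * (K + c))) :=
      le_mul_of_one_le_right (by positivity) hKc
    have h2 : 1 ≤ δ / T := by
      rw [le_div_iff₀ hT]
      nlinarith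
    have h3 : δ * K * ((T * L) ^ 0 / T) * (1 + c) * (K + c) =
        δ / T * (K * ((1 + c) * (K + c))) := by
      field_simp
    nlinarith
  have hterm : δ * K * ((T * L) ^ (k + 1) / T) * (1 + c) * (K + c) =
      L * δ * (L * T) ^ k * (K * ((1 + c) * (K + c))) := by
    rw [pow_succ, mul_comm T L]
    field_simp
  rw [hterm] at hc
  rcases k with _ | k
  · exfalso
    have h1 : L * δ ≤ L * δ * (K * ((1 + c) * (K + c))) :=
      le_mul_of_one_le_right (by positivity) hKc
    rw [pow_zero, mul_one] at hc
    nlinarith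
  refine ⟨fun j => if j = 0 then k + 1 else k + 2, ?_, ?_⟩
  · rw [Finset.sum_range_succ']
    simp [Nat.add_mul]
  have hD : K ^ 2 * defect L T (fun j => if j = 0 then k + 1 else k + 2) (M + 1) ≤
      (K ^ 2 * (L * T) ^ (k + 2)) / (k + 2).factorial + L * T / (k + 3).factorial *
        (K ^ 2 * (L * T) ^ (k + 2) * ∑ j ∈ Finset.range M, Real.exp (L * T) ^ (j + 1)) := by
    rw [defect, Finset.sum_range_succ']
    simp only [Nat.add_eq_zero_iff, one_ne_zero, and_false, if_false, if_true, pow_zero, one_mul]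
    rw [← Finset.sum_mul]
    refine le_of_eq ?_
    ring
  have hP' : K ^ 2 * (L * T) ^ (k + 2) + K ^ 2 * (L * T) ^ (k + 2) *
      ∑ j ∈ Finset.range M, Real.exp (L * T) ^ (j + 1) ≤ c := by
    refine le_trans (le_of_eq ?_) hP
    rw [Finset.sum_range_succ']
    ring
  have hLT0 : 0 < L * T := mul_pos hL hT
  set g' := K ^ 2 * (L * T) ^ (k + 2) with hg'
  set s := g' * ∑ j ∈ Finset.range M, Real.exp (L * T) ^ (j + 1) with hs
  have hg'0 : 0 ≤ g' := by positivity
  have hs0 : 0 ≤ s := by positivity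
  rcases k with _ | k
  · have hMN : g' * ((M : ℝ) + 1) ≤ c := by
      refine le_trans ?_ hP
      refine mul_le_mul_of_nonneg_left ?_ hg'0
      have := Finset.card_nsmul_le_sum (Finset.range (M + 1))
        (fun j => Real.exp (L * T) ^ j) 1 fun j _ => one_le_pow₀ (Real.one_le_exp hLT0.le)
      simpa using this
    have e1 : (((0 : ℕ) + 2).factorial : ℝ) = 2 := by norm_num [Nat.factorial]
    have e2 : (((0 : ℕ) + 3).factorial : ℝ) = 6 := by norm_num [Nat.factorial]
    rw [e1, e2] at hD
    refine hD.trans ?_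
    set g := K ^ 2 * (L * T) with hg
    have hg0 : 0 ≤ g := by positivity
    have hgh : L * T ≤ g := le_mul_of_one_le_left hLT0.le (one_le_pow₀ hK)
    have hgg : g' = g * (L * T) := by rw [hg', hg]; ring
    have hw : g * (67 / 100) ≤ c := by
      refine le_trans ?_ hMN
      have e : g' * ((M : ℝ) + 1) = g * (L * T * (M + 1)) := by rw [hgg]; ring
      rw [e]
      refine mul_le_mul_of_nonneg_left ?_ hg0
      push_cast at hδ
      nlinarith
    have h1 : c ^ 2 + 67 / 100 * g * (1 + c) < 1 / 2 := by
      refine lt_of_le_of_lt ?_ hc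
      have a1 : 67 / 100 * (g * (1 + c)) ≤ L * δ * (g * (1 + c)) :=
        mul_le_mul_of_nonneg_right hLδ.le (by positivity)
      have a2 : 0 ≤ L * δ * (L * T) * K * (1 + c) * c := by positivity
      have a3 : L * δ * (L * T) ^ (0 + 1) * (K * ((1 + c) * (K + c))) =
        L * δ * (g * (1 + c)) + L * δ * (L * T) * K * (1 + c) * c := by rw [hg]; ring
      rw [a3]
      linarith
    have h2 : g * (L * T) ≤ g * g := mul_le_mul_of_nonneg_left hgh hg0
    have h3 : L * T * s ≤ g * c :=
      mul_le_mul hgh (by linarith) hs0 hg0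
    have h4 : (67 / 100 * g) ^ 2 ≤ c ^ 2 := pow_le_pow_left₀ (by positivity) (by linarith) 2
    have h5 : 67 / 100 * g * (g * (67 / 100)) ≤ 67 / 100 * g * c :=
      mul_le_mul_of_nonneg_left hw (by positivity)
    have h6 : g ≤ 4615 / 10000 := by
      by_contra! hn
      nlinarith
    have h7 := mul_nonneg hg0 (sub_nonneg.2 h6)
    rw [hgg]
    linarith
  · have hf : (6 : ℝ) ≤ ((k + 1 + 2).factorial : ℝ) := by
      have : Nat.factorial 3 ≤ (k + 1 + 2).factorial := Nat.factorial_le (by lia)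
      exact_mod_cast this
    have hf3 : (6 : ℝ) ≤ ((k + 1 + 3).factorial : ℝ) := by
      refine hf.trans ?_
      exact_mod_cast Nat.factorial_le (by lia)
    have h1 : g' / (k + 1 + 2).factorial ≤ g' / 6 := by gcongr
    have h2 : L * T / (k + 1 + 3).factorial * s ≤ 1 / 6 * s := by
      gcongr
      linarith
    have h3 : c ≤ 7072 / 10000 := by
      refine abs_le_of_sq_le_sq' ?_ (by norm_num) |>.2
      linarith
    linarith

theorem eval_along_sum_sq [Fintype σ] (x v : EuclideanSpace ℝ σ) :
    eval (fun j => x j) (along (fun j => v j) (∑ j, X j ^ 2)) = 2 * inner ℝ x v := by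
  rw [map_sum, map_sum, PiLp.inner_apply, Finset.mul_sum]
  refine Finset.sum_congr rfl fun j _ => ?_
  simp [along, mkDerivation_X, sq]
  ring

theorem eval_sum_sq [Fintype σ] (x : EuclideanSpace ℝ σ) :
    eval (fun j => x j) (∑ j, X j ^ 2) = ‖x‖ ^ 2 := by
  simp [EuclideanSpace.norm_sq_eq]

theorem totalDegree_sum_sq_le [Fintype σ] :
    (∑ j, X j ^ 2 : MvPolynomial σ ℝ).totalDegree ≤ 2 :=
  totalDegree_finsetSum_le fun j _ => by simp

theorem isSumSq_C_mul {V : MvPolynomial σ ℝ} (hV : IsSumSq V) {a : ℝ} (ha : 0 ≤ a) :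
    IsSumSq (C a * V) := by
  refine IsSumSq.mul ?_ hV
  rw [← Real.mul_self_sqrt ha, C_mul]
  exact IsSumSq.mul_self _

/-- The Lie derivative bound of `lyapunov` for exponentially stable trajectories. -/
theorem lyapunov_decay_bound {K S a y : ℝ} (hK : 1 ≤ K) (hS : 0 ≤ S)
    (hKS : K ^ 2 * S ≤ 131 / 1000) (ha : 0 ≤ a) (hy : y ^ 2 ≤ a ^ 2 / 2) :
    (y + K * a * S) ^ 2 - a ^ 2 + 2 * (K * a * (1 + S)) * a * S ≤ -(1 / 1000) * a ^ 2 := by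
  have h1 : y ≤ 70715 / 100000 * a := by
    refine abs_le_of_sq_le_sq' ?_ (by positivity) |>.2
    nlinarith
  have hKS1 : K * S ≤ 131 / 1000 := by nlinarith [mul_nonneg (by linarith : 0 ≤ K) hS]
  have hS1 : S ≤ 131 / 1000 := by nlinarith
  have h2 : (y + K * a * S) ^ 2 ≤ y ^ 2 + 2 * (70715 / 100000 * a) * (131 / 1000 * a) +
      (131 / 1000 * a) ^ 2 := by
    have h4 : K * a * S ≤ 131 / 1000 * a := by nlinarith
    have h5 : 0 ≤ K * a * S := by positivity
    have h6 := mul_le_mul h1 h4 h5 (by positivity)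
    have h7 := pow_le_pow_left₀ h5 h4 2
    linarith
  have h8 : K * S * (1 + S) ≤ 131 / 1000 * (1131 / 1000) :=
    mul_le_mul hKS1 (by linarith) (by positivity) (by positivity)
  have h9 := mul_le_mul_of_nonneg_right h8 (sq_nonneg a)
  linarith [sq_nonneg a]

end ConverseSOS

/-- the main converse result.  If a polynomial vector field of degree `q` is
exponentially stable, then there is a sum-of-squares Lyapunov function of degree at most
`2·q^{Nk−1}` which is exponentially decreasing on `M`. -/
theorem converse_sos_lyapunov {n q : ℕ} (hq : 1 ≤ q)
    (f : EuclideanSpace ℝ (Fin n) → EuclideanSpace ℝ (Fin n))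
    (F : Fin n → MvPolynomial (Fin n) ℝ)
    (hdeg : ∀ i, (F i).totalDegree ≤ q)
    (hf : ∀ (x : EuclideanSpace ℝ (Fin n)) (i : Fin n),
      f x i = MvPolynomial.eval (fun j => x j) (F i))
    (φ : ℝ → EuclideanSpace ℝ (Fin n) → EuclideanSpace ℝ (Fin n))
    (hφ0 : ∀ x, φ 0 x = x)
    (hφd : ∀ x : EuclideanSpace ℝ (Fin n), ∀ t ≥ (0:ℝ),
      HasDerivAt (fun s => φ s x) (f (φ t x)) t)
    (hφsemi : ∀ t ≥ (0:ℝ), ∀ s ≥ (0:ℝ), ∀ x, φ (t + s) x = φ t (φ s x))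
    (K lam r : ℝ) (hK : 1 ≤ K) (hlam : 0 < lam) (hr : 0 < r)
    (M : Set (EuclideanSpace ℝ (Fin n)))
    (hM : M ⊆ Metric.closedBall 0 r) (hMne : M.Nonempty)
    (hstab : ∀ t ≥ (0:ℝ), ∀ x ∈ Metric.closedBall (0 : EuclideanSpace ℝ (Fin n)) (2 * K * r),
      ‖φ t x‖ ≤ K * ‖x‖ * Real.exp (-lam * t))
    (L : ℝ) (hL : 0 < L)
    (hfL : ∀ y ∈ Metric.closedBall (0 : EuclideanSpace ℝ (Fin n)) (4 * K * r),
      ∀ z ∈ Metric.closedBall (0 : EuclideanSpace ℝ (Fin n)) (4 * K * r),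
        ‖f y - f z‖ ≤ L * ‖y - z‖)
    (T : ℝ) (N : ℕ) (hT : 0 < T)
    (hNT : Real.log (2 * K ^ 2) / (2 * lam) < N * T)
    (hT2 : T < 1 / (2 * L))
    (k : ℕ) (hc1 : cval K T L N k < K)
    (hc2 : cval K T L N k ^ 2 +
        Real.log (2 * K ^ 2) / (2 * lam) * K * ((T * L) ^ k / T) *
          (1 + cval K T L N k) * (K + cval K T L N k) < 1 / 2)
    (hc3 : cval K T L N k ^ 2 <
        lam / (K * L * Real.log (2 * K ^ 2)) * (1 - (2 * K ^ 2) ^ (-(L / lam)))) :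
    ∃ α β γ : ℝ, 0 < α ∧ 0 < β ∧ 0 < γ ∧
      ∃ V : MvPolynomial (Fin n) ℝ,
        (∃ (m : ℕ) (h : Fin m → MvPolynomial (Fin n) ℝ), V = ∑ j, (h j) ^ 2) ∧
        V.totalDegree ≤ 2 * q ^ (N * k - 1) ∧
        ∀ x ∈ M,
          α * ‖x‖ ^ 2 ≤ MvPolynomial.eval (fun j => x j) V ∧
          MvPolynomial.eval (fun j => x j) V ≤ β * ‖x‖ ^ 2 ∧
          (∑ i : Fin n, MvPolynomial.eval (fun j => x j) (MvPolynomial.pderiv i V) * f x i)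
            ≤ -γ * ‖x‖ ^ 2 := by
  open ConverseSOS MvPolynomial in
  have hfF : ∀ x, f x = field F x := fun x => by
    ext i
    rw [hf]
    rfl
  have hKr : 0 < K * r := by positivity
  have hzero : f 0 = 0 := by
    have h1 : ∀ t ≥ (0 : ℝ), φ t 0 = 0 := fun t ht => by
      simpa using hstab t ht 0 (by simp; positivity)
    have h2 := hφd 0 1 zero_le_one
    rw [h1 1 zero_le_one] at h2
    refine h2.unique
      ((hasDerivAt_const (1 : ℝ) (0 : EuclideanSpace ℝ (Fin n))).congr_of_eventuallyEq ?_)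
    filter_upwards [lt_mem_nhds (zero_lt_one (α := ℝ))] with t ht using h1 t ht.le
  have h : LipschitzField F L (4 * K * r) :=
    ⟨hL.le, by rw [← hfF, hzero], fun y hy z hz => by simpa only [hfF] using hfL y hy z hz⟩
  set δ := Real.log (2 * K ^ 2) / (2 * lam) with hδ
  have hδ0 : 0 < δ := div_pos (Real.log_pos (by nlinarith)) (by positivity)
  have hMr : ∀ x ∈ M, ‖x‖ ≤ r := fun x hx => by simpa using hM hx
  have hstab' : ∀ x ∈ M, ∀ t ≥ 0, ‖φ t x‖ ≤ K * ‖x‖ * Real.exp (-lam * t) :=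
    fun x hx t ht => hstab t ht x (by
      have := hMr x hx
      simp only [Metric.mem_closedBall, dist_zero_right]
      nlinarith)
  have hbd : ∀ x ∈ M, ∀ t ≥ 0, ‖φ t x‖ ≤ K * ‖x‖ := fun x hx t ht =>
    (hstab' x hx t ht).trans (mul_le_of_le_one_right (by positivity)
      (Real.exp_le_one_iff.2 (by nlinarith)))
  have hhalf : ∀ x ∈ M, ∀ t ≥ δ, ‖φ t x‖ ^ 2 ≤ ‖x‖ ^ 2 / 2 := by
    intro x hx t ht
    have h1 := pow_le_pow_left₀ (norm_nonneg _) (hstab' x hx t (hδ0.le.trans ht)) 2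
    refine h1.trans ?_
    have h2 : Real.exp (-lam * t) ^ 2 ≤ (2 * K ^ 2)⁻¹ := by
      rw [← Real.exp_nat_mul, ← Real.exp_log (show 0 < 2 * K ^ 2 by positivity), ← Real.exp_neg,
        Real.exp_le_exp]
      have : Real.log (2 * K ^ 2) = 2 * lam * δ := by
        rw [hδ]
        field_simp
      rw [this]
      push_cast
      nlinarith
    rw [mul_pow, mul_pow]
    refine (mul_le_mul_of_nonneg_left h2 (by positivity)).trans (le_of_eq ?_)
    field_simp
  have hu : ∀ x, ∀ t ≥ (0 : ℝ), HasDerivAt (fun s => φ s x) (field F (φ t x)) t :=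
    fun x t ht => by
      rw [← hfF]
      exact hφd x t ht
  have hdeg2 : (∑ j, X j ^ 2 : MvPolynomial (Fin n) ℝ).totalDegree ≤ 2 * q ^ (N * k - 1) :=
    totalDegree_sum_sq_le.trans (Nat.le_mul_of_pos_right _ (Nat.pow_pos hq))
  have hsq : IsSumSq (∑ j, X j ^ 2 : MvPolynomial (Fin n) ℝ) :=
    IsSumSq.sum fun j _ => by rw [sq]; exact IsSumSq.mul_self _
  rcases le_or_gt (L * δ) (67 / 100) with hτ | hτ
  · refine ⟨1, 1, 2 * (1 / (200 * δ)), one_pos, one_pos, by positivity, ∑ j, X j ^ 2,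
      exists_sum_sq_of_isSumSq hsq, hdeg2, fun x hx => ⟨?_, ?_, ?_⟩⟩
    · rw [eval_sum_sq, one_mul]
    · rw [eval_sum_sq, one_mul]
    · rw [← eval_along _ _ (∑ j, X j ^ 2), eval_along_sum_sq, hfF]
      have h1 := h.inner_field_le hδ0 hτ (hu x) (fun t ht => (hbd x hx t ht).trans (by
        nlinarith [hMr x hx])) (by simpa only [hφ0] using hhalf x hx δ le_rfl)
      simp only [hφ0] at h1
      linarith
  · have hLT : L * T < 1 / 2 := by
      rw [lt_div_iff₀ (by positivity)] at hT2
      linarith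
    obtain ⟨μ, hμ, hS⟩ := exists_defect_le hK hL hT hLT hNT hτ hc2
    set S := defect L T μ N with hSdef
    have hS0 : 0 ≤ S := by
      rw [hSdef, defect]
      positivity
    have hS1 : S ≤ 1 := by nlinarith
    have hexp : Real.exp (L * T) * (2 * (K * r)) < 4 * K * r := by
      have h1 : Real.exp (L * T) < 2 :=
        (Real.exp_lt_exp.2 hLT).trans (by
          linarith [exp_le_one_add_add (x := 1 / 2) (by norm_num) (by norm_num)])
      nlinarith
    have hb : ∀ x ∈ M, Real.exp (L * T) * (2 * (K * ‖x‖)) < 4 * K * r := fun x hx =>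
      lt_of_le_of_lt (by gcongr; exact hMr x hx) hexp
    set η := 1 / (4000 * L) with hη
    have hη0 : 0 < η := by positivity
    refine ⟨η, N * (T * (K * (1 + S)) ^ 2) + η, 1 / 2000, hη0, by positivity, by positivity,
      lyapunov F μ T N + C η * ∑ j, X j ^ 2,
      exists_sum_sq_of_isSumSq ((isSumSq_lyapunov μ hT.le N).add (isSumSq_C_mul hsq hη0.le)),
      ?_, fun x hx => ?_⟩
    · refine (totalDegree_add _ _).trans (max_le ?_ ?_)
      · rw [← hμ]
        exact totalDegree_lyapunov_le hq hdeg μ T N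
      · rw [← smul_eq_C_mul]
        exact (totalDegree_smul_le _ _).trans hdeg2
    have hev : eval (fun j => x j) (lyapunov F μ T N + C η * ∑ j, X j ^ 2) =
        eval (fun j => x j) (lyapunov F μ T N) + η * ‖x‖ ^ 2 := by
      rw [map_add, map_mul, eval_C, eval_sum_sq]
    rw [hev]
    refine ⟨?_, ?_, ?_⟩
    · refine le_add_of_nonneg_left ?_
      obtain ⟨m, g, hg⟩ := exists_sum_sq_of_isSumSq (isSumSq_lyapunov (F := F) μ hT.le N)
      rw [hg, map_sum]
      exact Finset.sum_nonneg fun j _ => by rw [map_pow]; positivity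
    · have h1 := h.eval_lyapunov_le hT.le (hb x hx) (hu x) (hbd x hx) μ hS1
      simp only [hφ0] at h1
      linarith
    · rw [← eval_along _ _ (lyapunov F μ T N + C η * ∑ j, X j ^ 2), hfF, map_add, map_add,
        ← smul_eq_C_mul, Derivation.map_smul, smul_eval, eval_along_sum_sq]
      have h1 := h.eval_along_lyapunov_le hT.le (hb x hx) (hu x) (hbd x hx) μ hS1
      simp only [hφ0] at h1
      have h2 := lyapunov_decay_bound hK hS0 hS (norm_nonneg x)
        (hhalf x hx _ hNT.le)
      have h3 := (real_inner_le_norm x (field F x)).trans (mul_le_mul_of_nonneg_left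
        (h.norm_le (y := x) (by nlinarith [hMr x hx])) (norm_nonneg x))
      have h4 := mul_le_mul_of_nonneg_left h3 hη0.le
      have h5 : η * (‖x‖ * (L * ‖x‖)) = 1 / 4000 * ‖x‖ ^ 2 := by
        rw [hη]
        field_simp
      linarith
end
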